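/- arXiv:1707.03701 — 2 statements merged into one kernel-verified Lean document; each statement's English description precedes it below -/
import Mathlib

section
/- For n ≥ 34, the forcing spectrum of the generalized Petersen graph P(n,2) equals the union of the two integer intervals [⌈n/12⌉ + 1, ⌈(n+3)/7⌉ + δ(n)] and [⌈(n+2)/6⌉, ⌈n/4⌉], where δ(n) = 1 if n ≡ 3 (mod 7) and δ(n) = 0 otherwise. -/
open SimpleGraph

/-- Vertices of the generalized Petersen graph `P(n,2)`:
`Sum.inl i` is the outer vertex `u_i`, `Sum.inr i` is the inner vertex `v_i`. -/
abbrev PV (n : ℕ) := ZMod n ⊕ ZMod n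

/-- The outer vertex `u_i`. -/
def pu {n : ℕ} (i : ZMod n) : PV n := Sum.inl i

/-- The inner vertex `v_i`. -/
def pv {n : ℕ} (i : ZMod n) : PV n := Sum.inr i

/-- The generalized Petersen graph `P(n,2)`, with edges
`u_i u_{i+2}`, `u_i v_i` (spokes) and `v_i v_{i+1}`, indices mod `n`. -/
def petersen (n : ℕ) : SimpleGraph (PV n) :=
  SimpleGraph.fromRel (fun x y =>
    (∃ i : ZMod n, x = pu i ∧ y = pu (i + 2)) ∨
    (∃ i : ZMod n, x = pu i ∧ y = pv i) ∨
    (∃ i : ZMod n, x = pv i ∧ y = pv (i + 1)))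

/-- `S` is a forcing set of the perfect matching `M` of `G`:
`S ⊆ M` and `S` is contained in no other perfect matching of `G`. -/
def IsForcingSet {V : Type*} (G : SimpleGraph V) (M : G.Subgraph) (S : Set (Sym2 V)) : Prop :=
  S ⊆ M.edgeSet ∧
    ∀ M' : G.Subgraph, M'.IsPerfectMatching → S ⊆ M'.edgeSet → M' = M

/-- The forcing number `f(G,M)`: the minimum cardinality of a forcing set of `M`. -/
noncomputable def forcingNumber {V : Type*} (G : SimpleGraph V) (M : G.Subgraph) : ℕ :=
  sInf {k | ∃ S : Set (Sym2 V), IsForcingSet G M S ∧ S.ncard = k}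

/-- Block `A` starting at position `i` (length 4). -/
def blockA (n : ℕ) (i : ZMod n) : Set (Sym2 (PV n)) :=
  {s(pu i, pu (i + 2)), s(pu (i + 1), pu (i + 3)), s(pv i, pv (i + 1)), s(pv (i + 2), pv (i + 3))}

/-- Block `B` at position `i` (length 1): a single spoke. -/
def blockB (n : ℕ) (i : ZMod n) : Set (Sym2 (PV n)) :=
  {s(pu i, pv i)}

/-- Block `C` starting at position `i` (length 3). -/
def blockC (n : ℕ) (i : ZMod n) : Set (Sym2 (PV n)) :=
  {s(pu i, pu (i + 2)), s(pu (i + 1), pv (i + 1)), s(pv (i + 2), pv (i + 3))}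

/-- Block `D` starting at position `i` (length 4). -/
def blockD (n : ℕ) (i : ZMod n) : Set (Sym2 (PV n)) :=
  {s(pu i, pu (i + 2)), s(pu (i + 1), pu (i + 3)), s(pv (i + 1), pv (i + 2)), s(pv (i + 3), pv (i + 4))}

/-- Length of an `A`/`B` block: `true` codes `A` (length 4), `false` codes `B` (length 1). -/
def abLen (b : Bool) : ℕ := if b then 4 else 1

/-- Edge set of a concatenation of `A`/`B` blocks starting at position `i`. -/
def abEdges (n : ℕ) : ZMod n → List Bool → Set (Sym2 (PV n))
  | _, [] => ∅
  | i, true :: L => blockA n i ∪ abEdges n (i + 4) L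
  | i, false :: L => blockB n i ∪ abEdges n (i + 1) L

/-- A perfect matching (given as a subgraph of `P(n,2)`) has type 1 if its edge set is
a cyclic concatenation of `A` and `B` blocks whose lengths sum to `n`. -/
def IsType1 {n : ℕ} (M : (petersen n).Subgraph) : Prop :=
  ∃ (i : ZMod n) (L : List Bool), (L.map abLen).sum = n ∧ M.edgeSet = abEdges n i L

/-- Length of a `C`/`D` block: `true` codes `C` (length 3), `false` codes `D` (length 4). -/
def cdLen (b : Bool) : ℕ := if b then 3 else 4

/-- Edge set of a concatenation of `C`/`D` blocks starting at position `i`. -/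
def cdEdges (n : ℕ) : ZMod n → List Bool → Set (Sym2 (PV n))
  | _, [] => ∅
  | i, true :: L => blockC n i ∪ cdEdges n (i + 3) L
  | i, false :: L => blockD n i ∪ cdEdges n (i + 4) L

/-- A perfect matching (given as a subgraph of `P(n,2)`) has type 2 if its edge set is
a cyclic concatenation of `C` and `D` blocks whose lengths sum to `n`. -/
def IsType2 {n : ℕ} (M : (petersen n).Subgraph) : Prop :=
  ∃ (i : ZMod n) (L : List Bool), (L.map cdLen).sum = n ∧ M.edgeSet = cdEdges n i L

namespace PetersenForcing

/-- The admissible columns: `(x, y, m)` leads from cut state `x` to cut state `y` and uses the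
edges of the column recorded in the bit mask `m`. -/
def transitions : List (ℕ × ℕ × ℕ) :=
  [(0, 3, 5), (0, 0, 2), (1, 2, 1), (2, 4, 2), (2, 7, 5), (3, 6, 1), (4, 1, 4), (5, 0, 0),
    (6, 5, 4), (7, 4, 0)]

/-- The edges used by a column leading from cut state `x` to cut state `y`. -/
def colMask (x y : ℕ) : ℕ := y / 2 % 2 + 2 * (1 - x / 4 - y / 2 % 2) + 4 * (y % 2)

/-- `x` and `y` are consecutive cut states of some perfect matching. -/
def Tr (x y : ℕ) : Prop := (x, y, colMask x y) ∈ transitions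

theorem natBeq_eq_decide (a b : ℕ) : Nat.beq a b = decide (a = b) :=
  Bool.eq_iff_iff.2 (by simp [Nat.beq_eq])

/-- Inclusion of bit masks. -/
def isSub (S m : ℕ) : Bool := Nat.beq (Nat.land S m) S

/-- The number of edges in a column mask. -/
def popc (S : ℕ) : ℕ := S % 2 + S / 2 % 2 + S / 4 % 2

theorem transitions_spec : ∀ e ∈ transitions,
    e.1 < 8 ∧ e.2.1 < 8 ∧ e.2.2 = colMask e.1 e.2.1 := by decide

theorem Tr.left_lt {x y : ℕ} (h : Tr x y) : x < 8 := (transitions_spec _ h).1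

theorem Tr.right_lt {x y : ℕ} (h : Tr x y) : y < 8 := (transitions_spec _ h).2.1

/-- `p` is a sequence of cut states for its first `k` columns, containing all marks of `T`. -/
def Consistent (T p : ℕ → ℕ) (k : ℕ) : Prop :=
  ∀ i < k, Tr (p i) (p (i + 1)) ∧ isSub (T i) (colMask (p i) (p (i + 1))) = true

/-- There is a `T`-consistent sequence of length `k` from `a` to `x` different from `σ`. -/
def Alt (σ T : ℕ → ℕ) (k a x : ℕ) : Prop :=
  ∃ p : ℕ → ℕ, p 0 = a ∧ p k = x ∧ Consistent T p k ∧ ∃ i ≤ k, p i ≠ σ i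

theorem Consistent.mono {T p : ℕ → ℕ} {k l : ℕ} (h : Consistent T p l) (hkl : k ≤ l) :
    Consistent T p k := fun i hi => h i (hi.trans_le hkl)

theorem Consistent.update {T p : ℕ → ℕ} {k y : ℕ} (h : Consistent T p k) (ht : Tr (p k) y)
    (hs : isSub (T k) (colMask (p k) y) = true) :
    Consistent T (Function.update p (k + 1) y) (k + 1) := by
  intro i hi
  rcases Nat.lt_succ_iff_lt_or_eq.1 hi with hi | rfl
  · rw [Function.update_of_ne (by omega), Function.update_of_ne (by omega)]
    exact h i hi
  · rw [Function.update_of_ne (by omega), Function.update_self]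
    exact ⟨ht, hs⟩

theorem alt_succ {σ T : ℕ → ℕ} {k a y : ℕ} (hσ : Consistent T σ k) :
    Alt σ T (k + 1) a y ↔ ∃ x, Tr x y ∧ isSub (T k) (colMask x y) = true ∧
      (Alt σ T k a x ∨ (a = σ 0 ∧ x = σ k ∧ y ≠ σ (k + 1))) := by
  constructor
  · rintro ⟨p, rfl, rfl, hc, hne⟩
    refine ⟨p k, (hc k (by omega)).1, (hc k (by omega)).2, ?_⟩
    by_cases h : ∃ i ≤ k, p i ≠ σ i
    · exact Or.inl ⟨p, rfl, rfl, hc.mono (by omega), h⟩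
    · push Not at h
      obtain ⟨i, hi, hne⟩ := hne
      refine Or.inr ⟨h 0 (by omega), h k le_rfl, ?_⟩
      rcases Nat.le_succ_iff.1 hi with hi | rfl
      · exact absurd (h i hi) hne
      · exact hne
  · rintro ⟨x, ht, hs, ⟨p, rfl, rfl, hc, i, hi, hne⟩ | ⟨rfl, rfl, hne⟩⟩
    · refine ⟨_, ?_, ?_, hc.update ht hs, i, by omega, ?_⟩
      · rw [Function.update_of_ne (by omega)]
      · rw [Function.update_self]
      · rwa [Function.update_of_ne (by omega)]
    · refine ⟨_, ?_, ?_, hσ.update ht hs, k + 1, le_rfl, ?_⟩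
      · rw [Function.update_of_ne (by omega)]
      · rw [Function.update_self]
      · rwa [Function.update_self]

theorem alt_zero {σ T : ℕ → ℕ} {a x : ℕ} : Alt σ T 0 a x ↔ a = x ∧ a ≠ σ 0 := by
  constructor
  · rintro ⟨p, rfl, rfl, -, i, hi, hne⟩
    obtain rfl : i = 0 := by omega
    exact ⟨rfl, hne⟩
  · rintro ⟨rfl, h⟩
    exact ⟨fun _ => a, rfl, rfl, fun i hi => absurd hi (by omega), 0, le_rfl, h⟩

/-- An alternative sequence that has met the state of `σ` can follow `σ` from then on. -/
theorem Alt.follow {σ T : ℕ → ℕ} {k l a : ℕ} (hσ : Consistent T σ l) (hkl : k ≤ l)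
    (h : Alt σ T k a (σ k)) : Alt σ T l a (σ l) := by
  induction l, hkl using Nat.le_induction with
  | base => exact h
  | succ m hm ih =>
    rw [alt_succ (hσ.mono (by omega))]
    exact ⟨σ m, (hσ m (by omega)).1, (hσ m (by omega)).2, Or.inl (ih (hσ.mono (by omega)))⟩

/-- Repetition of the bit `1` in each of eight rows of eight bits. -/
def rowOnes : ℕ := 72340172838076673

/-- Column `x` of the relation `r`, placed in column `y`. -/
def moveCol (r x y : ℕ) : ℕ := Nat.shiftLeft (Nat.land (Nat.shiftRight r x) rowOnes) y

/-- The contribution of the transition `e` to the next relation. -/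
def stepOne (q m t r : ℕ) (e : ℕ × ℕ × ℕ) : ℕ :=
  bif (Nat.beq e.1 m && !Nat.beq e.2.1 t) then
    Nat.lor (moveCol r e.1 e.2.1) (Nat.shiftLeft 1 (8 * q + e.2.1))
  else moveCol r e.1 e.2.1

/-- The relation after one more column: the reference sequence starts at `q` and passes from
`m` to `t`, and the edges in `S` are marked. Relations on cut states are coded as 8 by 8 bit
matrices. -/
def stepRel (q m t S r : ℕ) : ℕ :=
  transitions.foldr (fun e acc => bif isSub S e.2.2 then Nat.lor (stepOne q m t r e) acc else acc) 0

theorem testBit_rowOnes (j : ℕ) : rowOnes.testBit j = decide (j < 64 ∧ j % 8 = 0) := by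
  by_cases h : j < 64
  · have : ∀ j < 64, rowOnes.testBit j = decide (j < 64 ∧ j % 8 = 0) := by decide +kernel
    exact this j h
  · have h2 : rowOnes < 2 ^ j :=
      lt_of_lt_of_le (by decide : rowOnes < 2 ^ 64) (Nat.pow_le_pow_right (by norm_num) (by omega))
    rw [Nat.testBit_lt_two_pow h2]
    simp [h]

theorem testBit_moveCol {r x y a b : ℕ} (hy : y < 8) (ha : a < 8) (hb : b < 8) :
    (moveCol r x y).testBit (8 * a + b) = (decide (b = y) && r.testBit (8 * a + x)) := by
  change ((((r >>> x) &&& rowOnes) <<< y).testBit (8 * a + b)) = _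
  rw [Nat.testBit_shiftLeft, Nat.testBit_land, Nat.testBit_shiftRight, testBit_rowOnes]
  by_cases h : b = y
  · subst h
    have h1 : x + (8 * a + b - b) = 8 * a + x := by omega
    have h2 : 8 * a + b - b < 64 ∧ (8 * a + b - b) % 8 = 0 := by omega
    have h3 : 8 * a + b ≥ b := by omega
    rw [h1, decide_eq_true h2, decide_eq_true h3]
    simp
  · by_cases h3 : 8 * a + b ≥ y
    · have : ¬ (8 * a + b - y < 64 ∧ (8 * a + b - y) % 8 = 0) := by omega
      rw [decide_eq_false this]
      simp [h]
    · rw [decide_eq_false h3]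
      simp [h]

theorem testBit_stepOne {q m t r a b : ℕ} {e : ℕ × ℕ × ℕ} (h2 : e.2.1 < 8)
    (ha : a < 8) (hb : b < 8) :
    (stepOne q m t r e).testBit (8 * a + b) = true ↔ e.2.1 = b ∧
      (r.testBit (8 * a + e.1) = true ∨ (a = q ∧ e.1 = m ∧ b ≠ t)) := by
  unfold stepOne
  by_cases h : (Nat.beq e.1 m && !Nat.beq e.2.1 t) = true
  · rw [h, cond_true]
    change (_ ||| (1 <<< (8 * q + e.2.1) : ℕ)).testBit _ = true ↔ _
    rw [Nat.testBit_lor, testBit_moveCol h2 ha hb, Nat.one_shiftLeft, Nat.testBit_two_pow]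
    rw [natBeq_eq_decide, natBeq_eq_decide, Bool.and_eq_true, Bool.not_eq_true', decide_eq_true_eq,
      decide_eq_false_iff_not] at h
    obtain ⟨rfl, h'⟩ := h
    simp only [Bool.or_eq_true, Bool.and_eq_true, decide_eq_true_eq]
    constructor
    · rintro (⟨hb', h⟩ | h)
      · exact ⟨hb'.symm, Or.inl h⟩
      · have : e.2.1 = b := by omega
        exact ⟨this, Or.inr ⟨by omega, trivial, this ▸ h'⟩⟩
    · rintro ⟨rfl, h | ⟨rfl, -, -⟩⟩
      · exact Or.inl ⟨rfl, h⟩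
      · exact Or.inr rfl
  · rw [Bool.not_eq_true] at h
    rw [h, cond_false, testBit_moveCol h2 ha hb]
    simp only [Bool.and_eq_true, decide_eq_true_eq]
    constructor
    · rintro ⟨rfl, h⟩
      exact ⟨rfl, Or.inl h⟩
    · rintro ⟨rfl, h' | ⟨rfl, rfl, h'⟩⟩
      · exact ⟨rfl, h'⟩
      · simp [natBeq_eq_decide, h'] at h

theorem testBit_stepRel {q m t S r a b : ℕ} (ha : a < 8) (hb : b < 8) :
    (stepRel q m t S r).testBit (8 * a + b) = true ↔
      ∃ x, Tr x b ∧ isSub S (colMask x b) = true ∧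
        (r.testBit (8 * a + x) = true ∨ (a = q ∧ x = m ∧ b ≠ t)) := by
  have key : ∀ l : List (ℕ × ℕ × ℕ), (∀ e ∈ l, e ∈ transitions) →
      ((l.foldr (fun e acc => bif isSub S e.2.2 then Nat.lor (stepOne q m t r e) acc else acc)
        0).testBit (8 * a + b) = true ↔ ∃ e ∈ l, isSub S e.2.2 = true ∧ e.2.1 = b ∧
          (r.testBit (8 * a + e.1) = true ∨ (a = q ∧ e.1 = m ∧ b ≠ t))) := by
    intro l
    induction l with
    | nil => simp
    | cons e l ih =>
      intro hl
      obtain ⟨-, h2, -⟩ := transitions_spec e (hl e (by simp))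
      specialize ih fun e he => hl e (by simp [he])
      rw [List.foldr_cons]
      simp only [List.mem_cons, exists_eq_or_imp]
      cases hS : isSub S e.2.2
      · rw [cond_false, ih]
        simp
      · rw [cond_true]
        change (_ ||| _ : ℕ).testBit _ = true ↔ _
        rw [Nat.testBit_lor, Bool.or_eq_true, testBit_stepOne h2 ha hb, ih]
        simp
  rw [stepRel, key transitions fun _ h => h]
  constructor
  · rintro ⟨⟨x, y, m'⟩, he, hs, rfl, h⟩
    have := (transitions_spec _ he).2.2
    dsimp only at this hs h ⊢
    subst this
    exact ⟨x, he, hs, h⟩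
  · rintro ⟨x, ht, hs, h⟩
    exact ⟨_, ht, hs, rfl, h⟩

/-- Every pair in the bit matrix `r` is joined by an alternative sequence. -/
def Below (σ T : ℕ → ℕ) (k r : ℕ) : Prop :=
  ∀ a < 8, ∀ x < 8, r.testBit (8 * a + x) = true → Alt σ T k a x

/-- The bit matrix `r` contains every pair joined by an alternative sequence. -/
def Above (σ T : ℕ → ℕ) (k r : ℕ) : Prop :=
  ∀ a < 8, ∀ x < 8, Alt σ T k a x → r.testBit (8 * a + x) = true

theorem Below.step {σ T : ℕ → ℕ} {k r : ℕ} (hσ : Consistent T σ k) (h : Below σ T k r) :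
    Below σ T (k + 1) (stepRel (σ 0) (σ k) (σ (k + 1)) (T k) r) := by
  intro a ha y hy hb
  rw [alt_succ hσ]
  obtain ⟨x, ht, hs, hx⟩ := (testBit_stepRel ha hy).1 hb
  exact ⟨x, ht, hs, hx.imp_left (h a ha x ht.left_lt)⟩

theorem Above.step {σ T : ℕ → ℕ} {k r : ℕ} (hσ : Consistent T σ k) (h : Above σ T k r) :
    Above σ T (k + 1) (stepRel (σ 0) (σ k) (σ (k + 1)) (T k) r) := by
  intro a ha y hy hb
  obtain ⟨x, ht, hs, hx⟩ := (alt_succ hσ).1 hb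
  exact (testBit_stepRel ha hy).2 ⟨x, ht, hs, hx.imp_left (h a ha x ht.left_lt)⟩

theorem testBit_of_isSub {r r' i : ℕ} (h : isSub r r' = true) (hi : r.testBit i = true) :
    r'.testBit i = true := by
  have h' : r &&& r' = r := Nat.eq_of_beq_eq_true h
  rw [← h', Nat.testBit_land, Bool.and_eq_true] at hi
  exact hi.2

theorem Below.mono {σ T : ℕ → ℕ} {k r r' : ℕ} (h : Below σ T k r') (hr : isSub r r' = true) :
    Below σ T k r := fun a ha x hx hb => h a ha x hx (testBit_of_isSub hr hb)

theorem Above.mono {σ T : ℕ → ℕ} {k r r' : ℕ} (h : Above σ T k r) (hr : isSub r r' = true) :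
    Above σ T k r' := fun a ha x hx hb => testBit_of_isSub hr (h a ha x hx hb)

/-- The relation before the first column. -/
def initRel (q : ℕ) : ℕ := Nat.sub 9241421688590303745 (Nat.shiftLeft 1 (9 * q))

theorem testBit_initRel : ∀ q < 8, ∀ a < 8, ∀ x < 8,
    (initRel q).testBit (8 * a + x) = decide (a = x ∧ a ≠ q) := by decide +kernel

theorem below_init {σ T : ℕ → ℕ} (h : σ 0 < 8) : Below σ T 0 (initRel (σ 0)) := by
  intro a ha x hx hb
  rw [testBit_initRel _ h a ha x hx, decide_eq_true_eq] at hb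
  exact alt_zero.2 hb

theorem above_init {σ T : ℕ → ℕ} (h : σ 0 < 8) : Above σ T 0 (initRel (σ 0)) := by
  intro a ha x hx hb
  rw [testBit_initRel _ h a ha x hx, decide_eq_true_eq]
  exact alt_zero.1 hb

/-- The bits `(a, a)`. -/
def diagBits : ℕ := 9241421688590303745

/-- No bit `(a, a)` is set. -/
def noDiag (r : ℕ) : Bool := Nat.beq (Nat.land r diagBits) 0

theorem testBit_diagBits : ∀ a < 8, diagBits.testBit (8 * a + a) = true := by decide +kernel

theorem testBit_diagBits_eq : ∀ i < 64, diagBits.testBit i = true → i % 9 = 0 := by decide +kernel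

theorem noDiag_iff (r : ℕ) : noDiag r = true ↔ ∀ a < 8, r.testBit (8 * a + a) = false := by
  have h0 : noDiag r = true ↔ r &&& diagBits = 0 := by
    rw [noDiag, natBeq_eq_decide, decide_eq_true_eq]
    rfl
  rw [h0]
  constructor
  · intro h a ha
    have := congrArg (fun z => z.testBit (8 * a + a)) h
    simpa [Nat.testBit_land, testBit_diagBits a ha] using this
  · intro h
    refine Nat.eq_of_testBit_eq fun i => ?_
    rw [Nat.testBit_land, Nat.zero_testBit]
    by_cases hi : i < 64
    · by_cases hd : diagBits.testBit i = true
      · have := testBit_diagBits_eq i hi hd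
        have h9 := h (i / 9) (by omega)
        rw [show 8 * (i / 9) + i / 9 = i by omega] at h9
        rw [h9, Bool.false_and]
      · simp [hd]
    · have : diagBits < 2 ^ i := lt_of_lt_of_le (by decide : diagBits < 2 ^ 64)
        (Nat.pow_le_pow_right (by norm_num) (by omega))
      rw [Nat.testBit_lt_two_pow this, Bool.and_false]

/-- The marks `T` force the closed sequence `σ` of length `n`. -/
def Forces (n : ℕ) (σ T : ℕ → ℕ) : Prop :=
  Consistent T σ n ∧ ∀ p, p n = p 0 → Consistent T p n → ∀ i ≤ n, p i = σ i

/-- The number of marked edges in the first `k` columns. -/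
def cost (T : ℕ → ℕ) (k : ℕ) : ℕ := ∑ i ∈ Finset.range k, popc (T i)

theorem Forces.not_alt {n : ℕ} {σ T : ℕ → ℕ} (h : Forces n σ T) (a : ℕ) : ¬ Alt σ T n a a := by
  rintro ⟨p, h0, hn, hc, i, hi, hne⟩
  exact hne (h.2 p (hn.trans h0.symm) hc i hi)

theorem Forces.not_alt_follow {n : ℕ} {σ T : ℕ → ℕ} (h : Forces n σ T) (hσ : σ n = σ 0) {k : ℕ}
    (hk : k ≤ n) : ¬ Alt σ T k (σ 0) (σ k) := fun ha =>
  h.not_alt (σ 0) (by simpa [hσ] using ha.follow h.1 hk)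

theorem forces_of_above {n r : ℕ} {σ T : ℕ → ℕ} (hn : 0 < n) (hσ : Consistent T σ n)
    (h : Above σ T n r) (hr : noDiag r = true) : Forces n σ T := by
  refine ⟨hσ, fun p hp hc i hi => ?_⟩
  by_contra hne
  have hlt : p 0 < 8 := (hc 0 hn).1.left_lt
  have := h (p 0) hlt (p 0) hlt ⟨p, rfl, hp, hc, i, hi, hne⟩
  rw [(noDiag_iff r).1 hr _ hlt] at this
  exact absurd this (by simp)

theorem Forces.noDiag {n r : ℕ} {σ T : ℕ → ℕ} (hF : Forces n σ T)
    (h : Below σ T n r) : noDiag r = true := by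
  rw [noDiag_iff]
  intro a ha
  by_contra hb
  exact hF.not_alt a (h a ha a ha (by simpa using hb))

/-- The successors of a cut state together with the masks of the columns. -/
def nexts (m : ℕ) : List (ℕ × ℕ) :=
  transitions.foldr (fun e acc => bif Nat.beq e.1 m then e.2 :: acc else acc) []

/-- The sets of marks inside a column. -/
def subMasks (mk : ℕ) : List ℕ := [0, 1, 2, 4, 5].filter fun S => isSub S mk

theorem mem_nexts {m : ℕ} {e : ℕ × ℕ} : e ∈ nexts m ↔ (m, e) ∈ transitions := by
  have key : ∀ l : List (ℕ × ℕ × ℕ),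
      e ∈ l.foldr (fun e acc => bif Nat.beq e.1 m then e.2 :: acc else acc) [] ↔ (m, e) ∈ l := by
    intro l
    induction l with
    | nil => simp
    | cons a l ih =>
      rw [List.foldr_cons, natBeq_eq_decide]
      by_cases h : a.1 = m
      · rw [decide_eq_true h, cond_true, List.mem_cons, ih, List.mem_cons]
        subst h
        exact or_congr_left ⟨fun h => Prod.ext rfl h, fun h => congrArg Prod.snd h⟩
      · rw [decide_eq_false h, cond_false, ih, List.mem_cons]
        exact ⟨Or.inr, fun h' => h'.resolve_left fun h'' => h (congrArg Prod.fst h'').symm⟩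
  exact key _

theorem Tr.mem_nexts {x y : ℕ} (h : Tr x y) : (y, colMask x y) ∈ nexts x :=
  PetersenForcing.mem_nexts.2 h

theorem Tr.mem_subMasks {x y S : ℕ} (h : Tr x y) (hS : isSub S (colMask x y) = true) :
    S ∈ subMasks (colMask x y) := by
  have key : ∀ e ∈ transitions, e.2.2 < 6 ∧ ∀ S < 6, isSub S e.2.2 = true → S ∈ subMasks e.2.2 := by
    decide +kernel
  obtain ⟨h1, h2⟩ := key _ h
  have h3 : S &&& colMask x y = S := Nat.eq_of_beq_eq_true hS
  have h4 : S ≤ colMask x y := h3 ▸ Nat.and_le_right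
  exact h2 S (by dsimp only at h1; omega) hS

theorem isSub_of_mem_subMasks {S mk : ℕ} (h : S ∈ subMasks mk) : isSub S mk = true :=
  (List.mem_filter.1 h).2

theorem isSub_refl (r : ℕ) : isSub r r = true := by
  rw [isSub, natBeq_eq_decide, decide_eq_true_eq]
  exact Nat.and_self r

theorem isSub_trans {a b c : ℕ} (h1 : isSub a b = true) (h2 : isSub b c = true) :
    isSub a c = true := by
  have h1 : a &&& b = a := Nat.eq_of_beq_eq_true h1
  have h2 : b &&& c = b := Nat.eq_of_beq_eq_true h2
  rw [isSub, natBeq_eq_decide, decide_eq_true_eq]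
  change a &&& c = a
  rw [← h1, Nat.and_assoc, h2]

/-- Pass the number `x` to `f` in evaluated form. -/
def forceNat {α : Type} (x : ℕ) (f : ℕ → α) : α := 
  Nat.casesOn x (f 0) fun p => f (Nat.succ p)

theorem forceNat_eq {α : Type} (x : ℕ) (f : ℕ → α) : forceNat x f = f x := by cases x <;> rfl

/-- The bit `i` of `r`. -/
def hasBit (r i : ℕ) : Bool := Nat.beq (Nat.mod (Nat.shiftRight r i) 2) 1

theorem hasBit_eq (r i : ℕ) : hasBit r i = r.testBit i := by
  rw [hasBit, natBeq_eq_decide, Nat.testBit_eq_decide_div_mod_eq, ← Nat.shiftRight_eq_div_pow]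
  rfl

theorem cost_succ (T : ℕ → ℕ) (k : ℕ) : cost T (k + 1) = cost T k + popc (T k) :=
  Finset.sum_range_succ _ _

theorem cost_zero (T : ℕ → ℕ) : cost T 0 = 0 := rfl

/-! ### Lower bounds -/

/-- The entry `(r, v)` is dominated by an entry of `l`. -/
def dominated (l : List (ℕ × ℕ)) (r v : ℕ) : Bool := l.any fun e => isSub e.1 r && Nat.ble e.2 v

/-- All one-column extensions of the state `m`, relation `r` and potential `v` satisfy `f`. -/
def lowerAll (q W m r v : ℕ) (f : ℕ → ℕ → ℕ → Bool) : Bool :=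
  (nexts m).all fun t => (subMasks t.2).all fun S =>
    forceNat (stepRel q m t.1 S r) fun r' => hasBit r' (8 * q + t.1) ||
      forceNat (v + W * popc S) fun v' => Nat.ble 1 v' && f t.1 r' (Nat.pred v')

/-- The table is closed under one-column extensions. -/
def lowerStep (q W : ℕ) (cert : ℕ → List (ℕ × ℕ)) : Bool :=
  (List.range 8).all fun m => (cert m).all fun e =>
    lowerAll q W m e.1 e.2 fun t r v => dominated (cert t) r v

/-- All extensions by `fuel` columns are dominated by the table. -/
def lowerInit (q W : ℕ) (cert : ℕ → List (ℕ × ℕ)) : ℕ → ℕ → ℕ → ℕ → Bool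
  | 0, m, r, v => dominated (cert m) r v
  | fuel + 1, m, r, v => lowerAll q W m r v fun t r v => lowerInit q W cert fuel t r v

/-- The entries of the table for forcing sets have potential at least `B`. -/
def lowerFinal (q B : ℕ) (cert : ℕ → List (ℕ × ℕ)) : Bool :=
  (cert q).all fun e => !noDiag e.1 || Nat.ble B e.2

/-- The entry `(r, v)` bounds the marking `T` of the first `k` columns from below. -/
def LowerEntry (W C : ℕ) (σ T : ℕ → ℕ) (k r v : ℕ) : Prop :=
  Below σ T k r ∧ v + k ≤ W * cost T k + C

theorem exists_of_dominated {W C k r v : ℕ} {σ T : ℕ → ℕ} {l : List (ℕ × ℕ)}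
    (h : dominated l r v = true) (hE : LowerEntry W C σ T k r v) :
    ∃ e ∈ l, LowerEntry W C σ T k e.1 e.2 := by
  obtain ⟨e, he, h⟩ := List.any_eq_true.1 h
  rw [Bool.and_eq_true] at h
  have := Nat.le_of_ble_eq_true h.2
  exact ⟨e, he, hE.1.mono h.1, by have := hE.2; omega⟩

theorem LowerEntry.next {q W C k n r v : ℕ} {σ T : ℕ → ℕ} {f : ℕ → ℕ → ℕ → Bool}
    (hF : Forces n σ T) (hσ : σ n = σ 0) (hq : σ 0 = q) (hk : k < n)
    (hE : LowerEntry W C σ T k r v) (h : lowerAll q W (σ k) r v f = true) :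
    ∃ r' v', LowerEntry W C σ T (k + 1) r' v' ∧ f (σ (k + 1)) r' v' = true := by
  obtain ⟨ht, hs⟩ := hF.1 k hk
  have h1 := List.all_eq_true.1 (List.all_eq_true.1 h _ ht.mem_nexts) _ (ht.mem_subMasks hs)
  rw [forceNat_eq, forceNat_eq, Bool.or_eq_true, Bool.and_eq_true] at h1
  have hb := hE.1.step (hF.1.mono hk.le)
  rw [hq] at hb
  rcases h1 with h1 | ⟨h1, h2⟩
  · rw [hasBit_eq] at h1
    exact absurd (hb q (hq ▸ (hF.1 0 (by omega)).1.left_lt) _ ht.right_lt h1)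
      (hq ▸ hF.not_alt_follow hσ hk)
  · have := Nat.le_of_ble_eq_true h1
    refine ⟨_, _, ⟨hb, ?_⟩, h2⟩
    have := hE.2
    rw [cost_succ, mul_add, Nat.pred_eq_sub_one]
    omega

theorem lower_bound {q W C B fuel n : ℕ} {σ T : ℕ → ℕ} {cert : ℕ → List (ℕ × ℕ)}
    (hinit : lowerInit q W cert fuel q (initRel q) C = true)
    (hstep : lowerStep q W cert = true) (hfin : lowerFinal q B cert = true)
    (hF : Forces n σ T) (hσ : σ n = σ 0) (hq : σ 0 = q) (hn : fuel < n) :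
    B + n ≤ W * cost T n + C := by
  have start : ∀ f k r v, lowerInit q W cert f (σ k) r v = true → LowerEntry W C σ T k r v →
      k + f < n → ∃ e ∈ cert (σ (k + f)), LowerEntry W C σ T (k + f) e.1 e.2 := by
    intro f
    induction f with
    | zero => exact fun k r v h hE _ => exists_of_dominated h hE
    | succ f ih =>
      intro k r v h hE hk
      obtain ⟨r', v', hE', h'⟩ := hE.next hF hσ hq (by omega) h
      have := ih (k + 1) r' v' h' hE' (by omega)
      rwa [show k + 1 + f = k + (f + 1) by omega] at this
  have main : ∀ k, fuel ≤ k → k ≤ n → ∃ e ∈ cert (σ k), LowerEntry W C σ T k e.1 e.2 := by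
    intro k hk
    induction k, hk using Nat.le_induction with
    | base =>
      intro _
      have := start fuel 0 (initRel q) C (hq ▸ hinit)
        ⟨hq ▸ below_init (hF.1 0 (by omega)).1.left_lt, by simp [cost_zero]⟩ (by omega)
      rwa [zero_add] at this
    | succ k hk ih =>
      intro hkn
      obtain ⟨e, he, hE⟩ := ih (by omega)
      have h1 := List.all_eq_true.1 (List.all_eq_true.1 hstep (σ k)
        (List.mem_range.2 (hF.1 k hkn).1.left_lt)) e he
      obtain ⟨r', v', hE', h'⟩ := hE.next hF hσ hq hkn h1
      exact exists_of_dominated h' hE'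
  obtain ⟨e, he, hb, hv⟩ := main n hn.le le_rfl
  rw [hσ, hq] at he
  have h1 := List.all_eq_true.1 hfin e he
  rw [hF.noDiag hb, Bool.not_true, Bool.false_or] at h1
  have := Nat.le_of_ble_eq_true h1
  omega

/-! ### Tables of markings -/

/-- All extensions of the entries of `A` by one column; a mark costs `W` and a column gains `d`. -/
def expand (q W d m t mk : ℕ) (A : List (ℕ × ℕ)) : List (ℕ × ℕ) :=
  A.flatMap fun e => (subMasks mk).flatMap fun S =>
    forceNat (stepRel q m t S e.1) fun r => forceNat (e.2 + W * popc S) fun v =>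
      bif hasBit r (8 * q + t) || !Nat.ble d v then [] else [(r, Nat.sub v d)]

theorem mem_expand {q W d m t mk : ℕ} {A : List (ℕ × ℕ)} {x : ℕ × ℕ} :
    x ∈ expand q W d m t mk A ↔ ∃ e ∈ A, ∃ S ∈ subMasks mk,
      (stepRel q m t S e.1).testBit (8 * q + t) = false ∧ d ≤ e.2 + W * popc S ∧
        x = (stepRel q m t S e.1, e.2 + W * popc S - d) := by
  simp only [expand, List.mem_flatMap, forceNat_eq]
  refine exists_congr fun e => and_congr_right fun _ => exists_congr fun S =>
    and_congr_right fun _ => ?_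
  rw [hasBit_eq]
  cases (stepRel q m t S e.1).testBit (8 * q + t)
  · by_cases h : d ≤ e.2 + W * popc S
    · rw [Nat.ble_eq_true_of_le h]
      simp only [Bool.not_true, Bool.or_false, cond_false, List.mem_singleton, h, true_and]
      rfl
    · have : Nat.ble d (e.2 + W * popc S) = false := by
        rw [Bool.eq_false_iff]
        exact fun h' => h (Nat.le_of_ble_eq_true h')
      simp [this, h]
  · simp

/-- Every entry of `B`, shifted by `t`, is dominated by an entry of `A`, shifted by `s`, whose
cost differs by a multiple of `W`. -/
def refines (W s : ℕ) (A : List (ℕ × ℕ)) (t : ℕ) (B : List (ℕ × ℕ)) : Bool :=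
  B.all fun b => A.any fun a => isSub a.1 b.1 && (Nat.ble (a.2 + s) (b.2 + t) &&
    Nat.beq (Nat.mod (Nat.sub (b.2 + t) (a.2 + s)) W) 0)

theorem exists_of_refines {W s t : ℕ} {A B : List (ℕ × ℕ)} (h : refines W s A t B = true)
    {b : ℕ × ℕ} (hb : b ∈ B) :
    ∃ a ∈ A, isSub a.1 b.1 = true ∧ ∃ j, b.2 + t = a.2 + s + W * j := by
  obtain ⟨a, ha, h⟩ := List.any_eq_true.1 (List.all_eq_true.1 h b hb)
  rw [Bool.and_eq_true, Bool.and_eq_true, natBeq_eq_decide, decide_eq_true_eq] at h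
  have h1 := Nat.le_of_ble_eq_true h.2.1
  obtain ⟨j, hj⟩ := Nat.dvd_of_mod_eq_zero h.2.2
  refine ⟨a, ha, h.1, j, ?_⟩
  have : b.2 + t - (a.2 + s) = W * j := hj
  omega

/-- Every entry of `A` is realized by a marking of the first `k` columns. -/
def Achieves (W d C : ℕ) (σ : ℕ → ℕ) (k c : ℕ) (A : List (ℕ × ℕ)) : Prop :=
  ∀ e ∈ A, ∃ T, Consistent T σ k ∧ Above σ T k e.1 ∧
    ∃ z, cost T k ≤ z ∧ W * z + C = e.2 + d * k + c

theorem Achieves.expand {W d C q k c : ℕ} {σ : ℕ → ℕ} {A : List (ℕ × ℕ)}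
    (hA : Achieves W d C σ k c A) (hq : σ 0 = q) (ht : Tr (σ k) (σ (k + 1))) :
    Achieves W d C σ (k + 1) c
      (expand q W d (σ k) (σ (k + 1)) (colMask (σ k) (σ (k + 1))) A) := by
  intro x hx
  obtain ⟨e, he, S, hS, -, hd, rfl⟩ := mem_expand.1 hx
  obtain ⟨T, hT, hab, z, hz, hv⟩ := hA e he
  have hag : ∀ i < k, Function.update T k S i = T i := fun i hi =>
    Function.update_of_ne (by omega) _ _
  have hc : Consistent (Function.update T k S) σ k := fun i hi => by
    rw [hag i hi]; exact hT i hi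
  have hab' : Above σ (Function.update T k S) k e.1 := by
    rintro a ha x hx ⟨p, h0, hk, hp, hne⟩
    exact hab a ha x hx ⟨p, h0, hk, fun i hi => by have := hp i hi; rwa [hag i hi] at this, hne⟩
  refine ⟨Function.update T k S, fun i hi => ?_, ?_, z + popc S, ?_, ?_⟩
  · rcases Nat.lt_succ_iff_lt_or_eq.1 hi with hi | rfl
    · exact hc i hi
    · rw [Function.update_self]
      exact ⟨ht, isSub_of_mem_subMasks hS⟩
  · have := hab'.step hc
    rwa [Function.update_self, hq] at this
  · have : cost (Function.update T k S) k = cost T k :=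
      Finset.sum_congr rfl fun i hi => by rw [hag i (Finset.mem_range.1 hi)]
    rw [cost_succ, this, Function.update_self]
    omega
  · dsimp only
    rw [mul_add, mul_add, mul_one]
    omega

theorem Achieves.refine {W d C k c s t : ℕ} {σ : ℕ → ℕ} {A B : List (ℕ × ℕ)}
    (hA : Achieves W d C σ k (c + s) A) (h : refines W s A t B = true) :
    Achieves W d C σ k (c + t) B := by
  intro b hb
  obtain ⟨a, ha, hr, j, hj⟩ := exists_of_refines h hb
  obtain ⟨T, hT, hab, z, hz, hv⟩ := hA a ha
  exact ⟨T, hT, hab.mono hr, z + j, by omega, by rw [mul_add]; omega⟩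

theorem Achieves.subset {W d C k c : ℕ} {σ : ℕ → ℕ} {A B : List (ℕ × ℕ)}
    (hA : Achieves W d C σ k c A) (h : B ⊆ A) : Achieves W d C σ k c B := fun e he => hA e (h he)

theorem achieves_init {q C : ℕ} (W d : ℕ) {σ : ℕ → ℕ} (hq : σ 0 = q) (h8 : q < 8) :
    Achieves W d C σ 0 0 [(initRel q, C)] := by
  intro e he
  obtain rfl := List.mem_singleton.1 he
  subst hq
  exact ⟨fun _ => 0, fun i hi => absurd hi (by omega), above_init h8, 0, by simp [cost_zero],
    by simp⟩

/-! ### Upper bounds -/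

/-- Some node of the certificate is refined by the table `A` at the state `m`. -/
def covered (W : ℕ) (N : List (ℕ × List (ℕ × ℕ))) (m : ℕ) (A : List (ℕ × ℕ)) : Bool :=
  N.any fun B => Nat.beq B.1 m && refines W 0 A 0 B.2

/-- The certificate is closed under extension by one column. -/
def upperStep (q W : ℕ) (N : List (ℕ × List (ℕ × ℕ))) : Bool :=
  N.all fun A => (nexts A.1).all fun t => covered W N t.1 (expand q W 1 A.1 t.1 t.2 A.2)

/-- All extensions by `fuel` columns are covered by the certificate. -/
def upperInit (q W : ℕ) (N : List (ℕ × List (ℕ × ℕ))) : ℕ → ℕ → List (ℕ × ℕ) → Bool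
  | 0, m, A => covered W N m A
  | fuel + 1, m, A => (nexts m).all fun t =>
      upperInit q W N fuel t.1 (expand q W 1 m t.1 t.2 A)

/-- The nodes at the initial state contain a forcing entry whose potential satisfies `ok`. -/
def upperFinal (q : ℕ) (ok : ℕ → Bool) (N : List (ℕ × List (ℕ × ℕ))) : Bool :=
  N.all fun A => !Nat.beq A.1 q || A.2.any fun e => noDiag e.1 && ok e.2

theorem exists_of_covered {W C m k : ℕ} {σ : ℕ → ℕ} {N : List (ℕ × List (ℕ × ℕ))}
    {A : List (ℕ × ℕ)} (h : covered W N m A = true) (hA : Achieves W 1 C σ k 0 A) :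
    ∃ B ∈ N, B.1 = m ∧ Achieves W 1 C σ k 0 B.2 := by
  obtain ⟨B, hB, h⟩ := List.any_eq_true.1 h
  rw [Bool.and_eq_true, natBeq_eq_decide, decide_eq_true_eq] at h
  exact ⟨B, hB, h.1, hA.refine h.2⟩

theorem upper_bound {q t W C fuel n : ℕ} {ok : ℕ → Bool} {σ : ℕ → ℕ}
    {N : List (ℕ × List (ℕ × ℕ))}
    (hinit : upperInit q W N fuel t (expand q W 1 q t (colMask q t) [(initRel q, C)]) = true)
    (hstep : upperStep q W N = true) (hfin : upperFinal q ok N = true)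
    (htr : ∀ i < n, Tr (σ i) (σ (i + 1))) (hσ : σ n = σ 0) (hq : σ 0 = q) (ht : σ 1 = t)
    (hn : fuel + 1 ≤ n) :
    ∃ T z v, Forces n σ T ∧ cost T n ≤ z ∧ ok v = true ∧ W * z + C = v + n := by
  have start : ∀ f k A, upperInit q W N f (σ k) A = true → Achieves W 1 C σ k 0 A →
      k + f ≤ n → ∃ B ∈ N, B.1 = σ (k + f) ∧ Achieves W 1 C σ (k + f) 0 B.2 := by
    intro f
    induction f with
    | zero => exact fun k A h hA _ => exists_of_covered h hA
    | succ f ih =>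
      intro k A h hA hk
      have := ih (k + 1) _ (List.all_eq_true.1 h _ (htr k (by omega)).mem_nexts)
        (hA.expand hq (htr k (by omega))) (by omega)
      rwa [show k + 1 + f = k + (f + 1) by omega] at this
  have main : ∀ k, 1 + fuel ≤ k → k ≤ n → ∃ B ∈ N, B.1 = σ k ∧ Achieves W 1 C σ k 0 B.2 := by
    intro k hk
    induction k, hk using Nat.le_induction with
    | base =>
      intro _
      have h0 := htr 0 (by omega)
      have h8 : q < 8 := hq ▸ h0.left_lt
      have := (achieves_init (C := C) W 1 hq h8).expand hq h0
      rw [hq, zero_add, ht] at this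
      exact start fuel 1 _ (ht ▸ hinit) (by simpa [ht] using this) (by omega)
    | succ k hk ih =>
      intro hkn
      obtain ⟨B, hB, hm, hA⟩ := ih (by omega)
      have h1 := List.all_eq_true.1 (List.all_eq_true.1 hstep B hB) _ (hm ▸ (htr k hkn).mem_nexts)
      rw [hm] at h1
      exact exists_of_covered h1 (hA.expand hq (htr k hkn))
  obtain ⟨B, hB, hm, hA⟩ := main n (by omega) le_rfl
  have h1 := List.all_eq_true.1 hfin B hB
  rw [hm, hσ, hq, natBeq_eq_decide, decide_eq_true rfl, Bool.not_true, Bool.false_or] at h1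
  obtain ⟨e, he, h1⟩ := List.any_eq_true.1 h1
  rw [Bool.and_eq_true] at h1
  obtain ⟨T, hT, hab, z, hz, hv⟩ := hA e he
  exact ⟨T, z, e.2, forces_of_above (by omega) hT hab h1.1, hz, h1.2, by omega⟩

/-! ### Exact values for families of words -/

/-- Every forcing-compatible marking of the first `k` columns is bounded by an entry of `A`. -/
def Completes (C : ℕ) (σ : ℕ → ℕ) (k c : ℕ) (A : List (ℕ × ℕ)) : Prop :=
  ∀ T, Consistent T σ k → (∀ i ≤ k, ¬ Alt σ T i (σ 0) (σ i)) →
    ∃ e ∈ A, Below σ T k e.1 ∧ e.2 + c ≤ cost T k + C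

/-- The table `A`, shifted by `c`, describes the cheapest markings of the first `k` columns. -/
def Describes (C : ℕ) (σ : ℕ → ℕ) (k c : ℕ) (A : List (ℕ × ℕ)) : Prop :=
  Achieves 1 0 C σ k c A ∧ Completes C σ k c A

theorem Completes.expand {C q k c : ℕ} {σ : ℕ → ℕ} {A : List (ℕ × ℕ)}
    (hA : Completes C σ k c A) (hq : σ 0 = q) (h8 : q < 8) (ht : Tr (σ k) (σ (k + 1))) :
    Completes C σ (k + 1) c
      (expand q 1 0 (σ k) (σ (k + 1)) (colMask (σ k) (σ (k + 1))) A) := by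
  intro T hT halt
  obtain ⟨e, he, hb, hv⟩ := hA T (hT.mono (by omega)) fun i hi => halt i (by omega)
  have hb' := hb.step (hT.mono (by omega))
  rw [hq] at hb'
  refine ⟨_, mem_expand.2 ⟨e, he, T k, ht.mem_subMasks (hT k (by omega)).2, ?_, by omega, rfl⟩,
    hb', ?_⟩
  · by_contra hbit
    exact halt (k + 1) le_rfl (hq ▸ hb' q h8 _ ht.right_lt (by simpa using hbit))
  · rw [cost_succ]
    dsimp only
    omega

theorem Completes.refine {C k c s t : ℕ} {σ : ℕ → ℕ} {A B : List (ℕ × ℕ)}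
    (hB : Completes C σ k (c + t) B) (h : refines 1 s A t B = true) :
    Completes C σ k (c + s) A := by
  intro T hT halt
  obtain ⟨b, hb, hbel, hv⟩ := hB T hT halt
  obtain ⟨a, ha, hr, j, hj⟩ := exists_of_refines h hb
  exact ⟨a, ha, hbel.mono hr, by omega⟩

/-- The tables `A`, shifted by `s`, and `B`, shifted by `t`, dominate each other. -/
def same (s : ℕ) (A : List (ℕ × ℕ)) (t : ℕ) (B : List (ℕ × ℕ)) : Bool :=
  refines 1 s A t B && refines 1 t B s A

theorem Describes.same {C k c s t : ℕ} {σ : ℕ → ℕ} {A B : List (ℕ × ℕ)}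
    (hA : Describes C σ k (c + s) A) (h : same s A t B = true) : Describes C σ k (c + t) B := by
  rw [PetersenForcing.same, Bool.and_eq_true] at h
  exact ⟨hA.1.refine h.1, hA.2.refine h.2⟩

/-- Remove dominated entries. -/
def prune : List (ℕ × ℕ) → List (ℕ × ℕ)
  | [] => []
  | a :: l => bif dominated (prune l) a.1 a.2 then prune l else
      a :: (prune l).filter fun e => !(isSub a.1 e.1 && Nat.ble a.2 e.2)

theorem prune_subset (A : List (ℕ × ℕ)) : prune A ⊆ A := by
  induction A with
  | nil => simp [prune]
  | cons a l ih =>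
    rw [prune]
    cases dominated (prune l) a.1 a.2
    · rw [cond_false]
      exact List.cons_subset_cons _ fun x hx => ih (List.mem_of_mem_filter hx)
    · rw [cond_true]
      exact fun x hx => List.mem_cons_of_mem _ (ih hx)

theorem exists_mem_prune {A : List (ℕ × ℕ)} {a : ℕ × ℕ} (ha : a ∈ A) :
    ∃ p ∈ prune A, isSub p.1 a.1 = true ∧ p.2 ≤ a.2 := by
  induction A with
  | nil => simp at ha
  | cons b l ih =>
    rw [prune]
    cases hd : dominated (prune l) b.1 b.2
    · rw [cond_false]
      rcases List.mem_cons.1 ha with rfl | ha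
      · exact ⟨_, List.mem_cons_self, isSub_refl _, le_rfl⟩
      · obtain ⟨p, hp, h1, h2⟩ := ih ha
        by_cases h : (isSub b.1 p.1 && Nat.ble b.2 p.2) = true
        · rw [Bool.and_eq_true] at h
          exact ⟨b, List.mem_cons_self, isSub_trans h.1 h1, (Nat.le_of_ble_eq_true h.2).trans h2⟩
        · exact ⟨p, List.mem_cons_of_mem _ (List.mem_filter.2 ⟨hp, by
            rwa [Bool.not_eq_true', ← Bool.not_eq_true]⟩), h1, h2⟩
    · rw [cond_true]
      rcases List.mem_cons.1 ha with rfl | ha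
      · obtain ⟨p, hp, h⟩ := List.any_eq_true.1 hd
        rw [Bool.and_eq_true] at h
        exact ⟨p, hp, h.1, Nat.le_of_ble_eq_true h.2⟩
      · exact ih ha

theorem Describes.prune {C k c : ℕ} {σ : ℕ → ℕ} {A : List (ℕ × ℕ)} (hA : Describes C σ k c A) :
    Describes C σ k c (prune A) := by
  refine ⟨hA.1.subset (prune_subset A), fun T hT halt => ?_⟩
  obtain ⟨e, he, hb, hv⟩ := hA.2 T hT halt
  obtain ⟨p, hp, h1, h2⟩ := exists_mem_prune he
  exact ⟨p, hp, hb.mono h1, by omega⟩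

/-- The table after the columns leading from `m` through the states in `u`. -/
def run (q : ℕ) : ℕ → List (ℕ × ℕ) → List ℕ → List (ℕ × ℕ)
  | _, A, [] => A
  | m, A, t :: u => run q t (prune (expand q 1 0 m t (colMask m t) A)) u

/-- From position `k` on, `σ` passes through the states in `u`. -/
def Follows (σ : ℕ → ℕ) : ℕ → List ℕ → Prop
  | _, [] => True
  | k, t :: u => Tr (σ k) t ∧ σ (k + 1) = t ∧ Follows σ (k + 1) u

theorem follows_append {σ : ℕ → ℕ} {k : ℕ} {u v : List ℕ} :
    Follows σ k (u ++ v) ↔ Follows σ k u ∧ Follows σ (k + u.length) v := by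
  induction u generalizing k with
  | nil => simp [Follows]
  | cons t u ih =>
    simp only [List.cons_append, Follows, ih, List.length_cons, and_assoc]
    rw [show k + 1 + u.length = k + (u.length + 1) by omega]

theorem Follows.tr {σ : ℕ → ℕ} {k : ℕ} {u : List ℕ} (h : Follows σ k u) :
    ∀ i < u.length, Tr (σ (k + i)) (σ (k + i + 1)) := by
  induction u generalizing k with
  | nil => simp
  | cons t u ih =>
    obtain ⟨h1, h2, h3⟩ := h
    intro i hi
    rcases i with _ | i
    · rw [add_zero, h2]
      exact h1
    · have := ih h3 i (by simpa using hi)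
      rwa [show k + 1 + i = k + (i + 1) by omega] at this

theorem Follows.getLast {σ : ℕ → ℕ} {k : ℕ} {u : List ℕ} (h : Follows σ k u) :
    σ (k + u.length) = u.getLastD (σ k) := by
  induction u generalizing k with
  | nil => simp
  | cons t u ih =>
    obtain ⟨h1, rfl, h3⟩ := h
    rw [List.getLastD_cons, ← ih h3, List.length_cons]
    congr 1
    omega

theorem Describes.run {C q k c : ℕ} {σ : ℕ → ℕ} {A : List (ℕ × ℕ)} {u : List ℕ}
    (hA : Describes C σ k c A) (hq : σ 0 = q) (h8 : q < 8) (hu : Follows σ k u) :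
    Describes C σ (k + u.length) c (run q (σ k) A u) := by
  induction u generalizing k A with
  | nil => exact hA
  | cons t u ih =>
    obtain ⟨h1, rfl, h3⟩ := hu
    have := ih (Describes.prune ⟨hA.1.expand hq h1, hA.2.expand hq h8 h1⟩) h3
    rw [List.length_cons, show k + (u.length + 1) = k + 1 + u.length by omega]
    exact this

theorem describes_init {q : ℕ} (C : ℕ) {σ : ℕ → ℕ} (hq : σ 0 = q) (h8 : q < 8) :
    Describes C σ 0 0 [(initRel q, C)] := by
  refine ⟨achieves_init 1 0 hq h8, fun T _ _ => ⟨_, List.mem_singleton_self _, ?_, by simp⟩⟩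
  subst hq
  exact below_init h8

/-- Repetition of a list. -/
def power (u : List ℕ) : ℕ → List ℕ
  | 0 => []
  | j + 1 => u ++ power u j

theorem length_power (u : List ℕ) (j : ℕ) : (power u j).length = u.length * j := by
  induction j with
  | zero => rfl
  | succ j ih => rw [power, List.length_append, ih, mul_add, mul_one, add_comm]

/-- Running through `u` returns to the state `m`, and shifts the table `A` by `δ`. -/
def loops (q m δ : ℕ) (A : List (ℕ × ℕ)) (u : List ℕ) : Bool :=
  Nat.beq (u.getLastD m) m && same 0 (run q m A u) δ A

theorem Describes.power {C q k c m δ : ℕ} {σ : ℕ → ℕ} {A : List (ℕ × ℕ)} {u : List ℕ} {j : ℕ}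
    (hA : Describes C σ k c A) (hq : σ 0 = q) (h8 : q < 8) (hm : σ k = m)
    (hl : loops q m δ A u = true) (hu : Follows σ k (power u j)) :
    Describes C σ (k + (PetersenForcing.power u j).length) (c + δ * j) A ∧
      σ (k + (PetersenForcing.power u j).length) = m := by
  induction j generalizing k c with
  | zero => exact ⟨hA, hm⟩
  | succ j ih =>
    rw [PetersenForcing.power, follows_append] at hu
    rw [loops, Bool.and_eq_true, natBeq_eq_decide, decide_eq_true_eq] at hl
    have h1 : Describes C σ (k + u.length) (c + δ) A :=
      ((hm ▸ hA.run hq h8 hu.1 : Describes C σ (k + u.length) (c + 0) _)).same hl.2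
    have h2 : σ (k + u.length) = m := by rw [hu.1.getLast, hm, hl.1]
    have := ih h1 h2 hu.2
    rw [PetersenForcing.power, List.length_append, ← add_assoc,
      show c + δ * (j + 1) = c + δ + δ * j by ring]
    exact this

/-- The cheapest forcing entry of the table `A` has cost `v`. -/
def closes (A : List (ℕ × ℕ)) (v : ℕ) : Bool :=
  (A.any fun e => noDiag e.1 && Nat.beq e.2 v) && A.all fun e => !noDiag e.1 || Nat.ble v e.2

/-- The forcing number of the closed sequence `σ` of length `n` is `k`. -/
def Exact (n : ℕ) (σ : ℕ → ℕ) (k : ℕ) : Prop :=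
  (∃ T, Forces n σ T ∧ cost T n = k) ∧ ∀ T, Forces n σ T → k ≤ cost T n

theorem Describes.exact {n c v : ℕ} {σ : ℕ → ℕ} {A : List (ℕ × ℕ)} (hA : Describes 0 σ n c A)
    (hn : 0 < n) (hσ : σ n = σ 0) (h : closes A v = true) : Exact n σ (v + c) := by
  rw [closes, Bool.and_eq_true] at h
  have low : ∀ T, Forces n σ T → v + c ≤ cost T n := by
    intro T hT
    obtain ⟨e, he, hb, hv⟩ := hA.2 T hT.1 fun i hi => hT.not_alt_follow hσ hi
    have := List.all_eq_true.1 h.2 e he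
    rw [hT.noDiag hb, Bool.not_true, Bool.false_or] at this
    have := Nat.le_of_ble_eq_true this
    omega
  refine ⟨?_, low⟩
  obtain ⟨e, he, h1⟩ := List.any_eq_true.1 h.1
  rw [Bool.and_eq_true, natBeq_eq_decide, decide_eq_true_eq] at h1
  obtain ⟨T, hT, hab, z, hz, hv⟩ := hA.1 e he
  have hF := forces_of_above hn hT hab h1.1
  have := low T hF
  exact ⟨T, hF, by omega⟩

/-- The words `P u^j Y v^i X` are valid and have the forcing numbers `a + δ * j + ε * i`. -/
def familyCheck (q : ℕ) (P u : List ℕ) (δ : ℕ) (Y v : List ℕ) (ε : ℕ) (X : List ℕ) (a : ℕ) :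
    Bool :=
  let m := P.getLastD q
  let A := run q q [(initRel q, 0)] P
  let l := Y.getLastD m
  let B := run q m A Y
  loops q m δ A u && (loops q l ε B v && closes (run q l B X) a)

theorem exact_of_familyCheck {q δ ε a j i : ℕ} {P u Y v X : List ℕ} {σ : ℕ → ℕ}
    (h : familyCheck q P u δ Y v ε X a = true) (h8 : q < 8) (hq : σ 0 = q)
    (hf : Follows σ 0 (P ++ (power u j ++ (Y ++ (power v i ++ X)))))
    (hpos : 0 < X.length)
    (hσ : σ (P ++ (power u j ++ (Y ++ (power v i ++ X)))).length = σ 0) :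
    Exact (P ++ (power u j ++ (Y ++ (power v i ++ X)))).length σ (a + (δ * j + ε * i)) := by
  rw [familyCheck, Bool.and_eq_true, Bool.and_eq_true] at h
  obtain ⟨h1, h2, h3⟩ := h
  simp only [follows_append] at hf
  obtain ⟨fP, fu, fY, fv, fX⟩ := hf
  have s1 := fP.getLast
  rw [hq] at s1
  obtain ⟨d2, s2⟩ := ((hq ▸ (describes_init 0 hq h8).run hq h8 fP :
    Describes 0 σ _ 0 (run q q [(initRel q, 0)] P))).power hq h8 s1 h1 fu
  have d3 := d2.run hq h8 fY
  have s3 := fY.getLast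
  rw [s2] at d3 s3
  obtain ⟨d4, s4⟩ := d3.power hq h8 s3 h2 fv
  have d5 := d4.run hq h8 fX
  rw [s4] at d5
  have hl : (P ++ (power u j ++ (Y ++ (power v i ++ X)))).length =
      0 + P.length + (power u j).length + Y.length + (power v i).length + X.length := by
    simp only [List.length_append]
    omega
  rw [hl] at hσ ⊢
  have := d5.exact (by omega) hσ h3
  rwa [zero_add (δ * j)] at this

/-- `u` is a sequence of states following `m`. -/
def isPath : ℕ → List ℕ → Bool
  | _, [] => true
  | m, t :: u => decide ((m, t, colMask m t) ∈ transitions) && isPath t u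

theorem getLastD_append (a : ℕ) (u v : List ℕ) :
    (u ++ v).getLastD a = v.getLastD (u.getLastD a) := by
  induction u generalizing a with
  | nil => rfl
  | cons t u ih => rw [List.cons_append, List.getLastD_cons, List.getLastD_cons, ih]

theorem isPath_append {m : ℕ} {u v : List ℕ} :
    isPath m (u ++ v) = (isPath m u && isPath (u.getLastD m) v) := by
  induction u generalizing m with
  | nil => rfl
  | cons t u ih => rw [List.cons_append, isPath, isPath, ih, List.getLastD_cons, Bool.and_assoc]

theorem isPath_power {m : ℕ} {u : List ℕ} (h : isPath m u = true) (hm : u.getLastD m = m) (j : ℕ) :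
    isPath m (power u j) = true ∧ (power u j).getLastD m = m := by
  induction j with
  | zero => exact ⟨rfl, rfl⟩
  | succ j ih =>
    rw [power, isPath_append, h, hm, ih.1]
    refine ⟨rfl, ?_⟩
    rw [getLastD_append, hm, ih.2]

theorem follows_of_isPath {m : ℕ} {u : List ℕ} (h : isPath m u = true) {σ : ℕ → ℕ} {k : ℕ}
    (hσ : ∀ i ≤ u.length, σ (k + i) = (m :: u).getD i 0) : Follows σ k u := by
  induction u generalizing m k with
  | nil => trivial
  | cons t u ih =>
    rw [isPath, Bool.and_eq_true, decide_eq_true_eq] at h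
    have h0 := hσ 0 (by simp)
    have h1 := hσ 1 (by simp)
    simp only [add_zero, List.getD_cons_zero, List.getD_cons_succ] at h0 h1
    refine ⟨h0 ▸ h.1, h1, ih h.2 fun i hi => ?_⟩
    have := hσ (i + 1) (by simpa using hi)
    rwa [List.getD_cons_succ, show k + (i + 1) = k + 1 + i by omega] at this

/-- Some closed sequence of length `n` has forcing number `k`. -/
def Realizable (n k : ℕ) : Prop :=
  ∃ σ : ℕ → ℕ, (∀ i < n, Tr (σ i) (σ (i + 1))) ∧ σ n = σ 0 ∧ Exact n σ k

/-- The pieces of a family fit together to closed words. -/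
def familyPath (q : ℕ) (P u Y v X : List ℕ) : Bool :=
  let m := P.getLastD q
  let l := Y.getLastD m
  isPath q P && (isPath m u && (isPath m Y && (isPath l v && (isPath l X && (
    Nat.beq (u.getLastD m) m && (Nat.beq (v.getLastD l) l && (
      Nat.beq (X.getLastD l) q && (!X.isEmpty && Nat.ble q 7))))))))

theorem realizable_of_familyCheck {q δ ε a : ℕ} {P u Y v X : List ℕ}
    (h : (familyPath q P u Y v X && familyCheck q P u δ Y v ε X a) = true) (j i : ℕ) :
    Realizable (P.length + u.length * j + Y.length + v.length * i + X.length)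
      (a + (δ * j + ε * i)) := by
  rw [Bool.and_eq_true] at h
  obtain ⟨hp, h⟩ := h
  simp only [familyPath, Bool.and_eq_true, natBeq_eq_decide, decide_eq_true_eq] at hp
  obtain ⟨p1, p2, p3, p4, p5, p6, p7, p8, p9, p10⟩ := hp
  obtain ⟨u1, u2⟩ := isPath_power p2 p6 j
  obtain ⟨v1, v2⟩ := isPath_power p4 p7 i
  set w := P ++ (power u j ++ (Y ++ (power v i ++ X))) with hw
  have hpath : isPath q w = true := by
    simp only [hw, isPath_append, u2, v2, p1, u1, p3, v1, p5, Bool.and_self]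
  have hlast : w.getLastD q = q := by
    simp only [hw, getLastD_append, u2, v2, p8]
  have hlen : P.length + u.length * j + Y.length + v.length * i + X.length = w.length := by
    simp only [hw, List.length_append, length_power]
    omega
  have hf : Follows (fun i => (q :: w).getD i 0) 0 w := follows_of_isPath hpath fun i _ => by simp
  have hσ : (fun i => (q :: w).getD i 0) w.length = (fun i => (q :: w).getD i 0) 0 := by
    have := hf.getLast
    rw [zero_add] at this
    exact this.trans hlast
  have hX : 0 < X.length := by
    rw [List.length_pos_iff]
    rintro rfl
    simp at p9
  rw [hlen]
  refine ⟨_, fun i hi => ?_, hσ, exact_of_familyCheck h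
    (Nat.lt_succ_of_le (Nat.le_of_ble_eq_true p10)) rfl hf hX hσ⟩
  have := hf.tr i hi
  rwa [zero_add] at this

/-! ### The families realizing the spectrum -/

/-- The cut states passed through by a block `A`. -/
def wordA : List ℕ := [3, 6, 5, 0]

/-- The cut states passed through by a block `C`. -/
def wordC : List ℕ := [2, 4, 1]

/-- The cut states passed through by a block `D`. -/
def wordD : List ℕ := [2, 7, 4, 1]

/-- The cut states passed through by `s` blocks `B`. -/
def wordB (s : ℕ) : List ℕ := power [0] s

/-- The word `A A B B B`. -/
def wordAABBB : List ℕ := wordA ++ (wordA ++ wordB 3)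

/-- The word `A B A B B B`. -/
def wordABABBB : List ℕ := wordA ++ (wordB 1 ++ (wordA ++ wordB 3))

/-- The word `C D`. -/
def wordCD : List ℕ := wordC ++ wordD

/-- A family of closed words is valid and has the asserted forcing numbers. -/
def family (q : ℕ) (P u : List ℕ) (δ : ℕ) (Y v : List ℕ) (ε : ℕ) (X : List ℕ) (a : ℕ) : Bool :=
  familyPath q P u Y v X && familyCheck q P u δ Y v ε X a

theorem family_AB : ∀ s ∈ [1, 2, 3, 4],
    family 0 (wordB 4) [] 0 [] [] 0 (wordB s) 2 = true ∧
    family 0 (wordB 8) (wordB 4) 1 [] [] 0 (wordB s) 3 = true ∧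
    family 0 wordABABBB [] 0 [] [] 0 (wordB s) 3 = true ∧
    family 0 wordABABBB [] 0 (wordB 4) (wordB 4) 1 (wordB s) 4 = true ∧
    family 0 (power wordABABBB 2) wordABABBB 2 [] [] 0 (wordB s) 5 = true ∧
    family 0 (power wordABABBB 2) wordABABBB 2 (wordB 4) (wordB 4) 1 (wordB s) 6 = true := by
  decide +kernel

theorem family_AABBB :
    family 0 (power wordAABBB 2) wordABABBB 2 [] [] 0 wordABABBB 6 = true ∧
    family 0 (power wordAABBB 3) wordABABBB 2 [] [] 0 wordABABBB 8 = true := by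
  decide +kernel

theorem realizable_AB {s : ℕ} (hs : s ∈ [1, 2, 3, 4]) (j i : ℕ) (hji : 0 < j + i) :
    Realizable (12 * j + 4 * i + s) (1 + 2 * j + i) := by
  obtain ⟨h1, h2, h3, h4, h5, h6⟩ := family_AB s hs
  have hB : ∀ s, (wordB s).length = s := fun s => by simp [wordB, length_power]
  have hU : wordABABBB.length = 12 := rfl
  have key : ∀ {n k n' k' : ℕ}, Realizable n k → n = n' → k = k' → Realizable n' k' := by
    rintro n k _ _ h rfl rfl
    exact h
  rcases j with _ | _ | j
  · rcases i with _ | _ | i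
    · omega
    · exact key (realizable_of_familyCheck h1 0 0) (by simp [hB]) (by simp)
    · exact key (realizable_of_familyCheck h2 i 0) (by simp [hB]; omega) (by omega)
  · rcases i with _ | i
    · exact key (realizable_of_familyCheck h3 0 0) (by simp [hB, hU]) (by simp)
    · exact key (realizable_of_familyCheck h4 0 i) (by simp [hB, hU]; omega) (by omega)
  · rcases i with _ | i
    · exact key (realizable_of_familyCheck h5 j 0) (by simp [hB, hU, length_power]; omega)
        (by omega)
    · exact key (realizable_of_familyCheck h6 j i) (by simp [hB, hU, length_power]; omega)
        (by omega)

/-- Every value of the interval `[⌈(n+2)/6⌉, ⌈n/4⌉]` is realized. -/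
theorem realizable_of_mem_upper_interval {n k : ℕ} (hn : 34 ≤ n) (h1 : (n + 7) / 6 ≤ k)
    (h2 : k ≤ (n + 3) / 4) : Realizable n k := by
  obtain ⟨f1, f2⟩ := family_AABBB
  by_cases e1 : n % 12 = 10 ∧ n + 2 = 6 * k
  · obtain ⟨j, rfl⟩ : ∃ j, n = 34 + 12 * j := ⟨(n - 34) / 12, by omega⟩
    obtain rfl : k = 6 + 2 * j := by omega
    have := realizable_of_familyCheck f1 j 0
    rwa [show 34 + 12 * j = 22 + 12 * j + 0 + 0 * 0 + 12 by omega,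
      show 6 + 2 * j = 6 + (2 * j + 0 * 0) by omega]
  by_cases e2 : n % 12 = 9 ∧ n + 3 = 6 * k
  · obtain ⟨j, rfl⟩ : ∃ j, n = 45 + 12 * j := ⟨(n - 45) / 12, by omega⟩
    obtain rfl : k = 8 + 2 * j := by omega
    have := realizable_of_familyCheck f2 j 0
    rwa [show 45 + 12 * j = 33 + 12 * j + 0 + 0 * 0 + 12 by omega,
      show 8 + 2 * j = 8 + (2 * j + 0 * 0) by omega]
  obtain ⟨j, s, hs, hw⟩ : ∃ j s, s < 4 ∧ n + 3 = 4 * k + 4 * j + s :=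
    ⟨(n + 3 - 4 * k) / 4, (n + 3 - 4 * k) % 4, by omega, by omega⟩
  have hk : 1 + 2 * j ≤ k := by omega
  obtain ⟨i, rfl⟩ := Nat.exists_eq_add_of_le hk
  have := realizable_AB (s := s + 1) (by interval_cases s <;> simp) j i (by omega)
  rwa [show n = 12 * j + 4 * i + (s + 1) by omega]

/-- The tails of the main family of words in the blocks `C` and `D`, with their contributions to
the forcing number. -/
def tails : List (List ℕ × ℕ) :=
  [([], 1), (wordC, 2), (power wordC 2, 2), (power wordC 3, 2), (power wordD 2, 2),
    (wordC ++ power wordD 2, 2), (power wordC 3 ++ power wordD 2, 3)]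

theorem family_CD : ∀ e ∈ tails,
    (∀ j < 4, family 1 (power wordCD j) [] 0 [] [] 0 (power wordC 4 ++ e.1) (e.2 + 1 + j) = true ∧
      family 1 (power wordCD j ++ power wordC 4) (power wordC 4) 1 [] [] 0
        (power wordC 4 ++ e.1) (e.2 + 2 + j) = true) ∧
    family 1 (power wordCD 3) wordCD 1 [] [] 0 (wordCD ++ e.1) (e.2 + 4) = true ∧
    family 1 (power wordCD 4) wordCD 1 [] [] 0 (power wordC 4 ++ e.1) (e.2 + 5) = true ∧
    family 1 (power wordCD 4) wordCD 1 (power wordC 4) (power wordC 4) 1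
      (power wordC 4 ++ e.1) (e.2 + 6) = true := by
  decide +kernel

theorem family_CDD :
    family 1 (power (wordC ++ power wordD 2) 2) [] 0 [] [] 0 (power wordC 4) 4 = true ∧
    family 1 (power (wordC ++ power wordD 2) 2 ++ power wordC 4) (power wordC 4) 1 [] [] 0
      (power wordC 4) 5 = true ∧
    family 1 (power (power wordC 2 ++ wordD) 3) [] 0 [] [] 0 (power wordC 2 ++ wordD) 7 = true ∧
    family 1 (power (power wordC 2 ++ wordD) 4) wordCD 1 [] [] 0 wordCD 8 = true ∧
    family 1 (power wordCD 3) [] 0 [] [] 0 (power wordC 3 ++ power wordD 2) 6 = true := by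
  decide +kernel

theorem realizable_CD {e : List ℕ × ℕ} (he : e ∈ tails) (j i : ℕ) (hji : 4 ≤ j + 4 * i) :
    Realizable (7 * j + 12 * i + e.1.length) (e.2 + j + i) := by
  obtain ⟨h1, h2, h3, h4⟩ := family_CD e he
  have hV : wordCD.length = 7 := rfl
  have hC : wordC.length = 3 := rfl
  have key : ∀ {n k n' k' : ℕ}, Realizable n k → n = n' → k = k' → Realizable n' k' := by
    rintro n k _ _ h rfl rfl
    exact h
  by_cases hj : j < 4
  · rcases i with _ | _ | i
    · omega
    · exact key (realizable_of_familyCheck (h1 j hj).1 0 0) (by simp [hV, hC, length_power]; omega)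
        (by omega)
    · exact key (realizable_of_familyCheck (h1 j hj).2 i 0) (by simp [hV, hC, length_power]; omega)
        (by omega)
  · obtain ⟨j, rfl⟩ : ∃ l, j = l + 4 := ⟨j - 4, by omega⟩
    rcases i with _ | _ | i
    · exact key (realizable_of_familyCheck h2 j 0) (by simp [hV, length_power]; omega)
        (by omega)
    · exact key (realizable_of_familyCheck h3 j 0) (by simp [hV, hC, length_power]; omega)
        (by omega)
    · exact key (realizable_of_familyCheck h4 j i) (by simp [hV, hC, length_power]; omega)
        (by omega)

/-- Every value of the interval `[⌈n/12⌉ + 1, ⌈(n+3)/7⌉ + δ(n)]` is realized. -/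
theorem realizable_of_mem_lower_interval {n k : ℕ} (hn : 34 ≤ n) (h1 : (n + 11) / 12 + 1 ≤ k)
    (h2 : k ≤ (n + 9) / 7 + if n % 7 = 3 then 1 else 0) : Realizable n k := by
  have hw : 7 * k ≤ n + 11 ∧ n + 12 ≤ 12 * k ∧ 7 * k ≠ n + 10 := by
    split_ifs at h2 <;> omega
  clear h1 h2
  obtain ⟨f1, f2, f3, f4, f5⟩ := family_CDD
  have key : ∀ {n k n' k' : ℕ}, Realizable n k → n = n' → k = k' → Realizable n' k' := by
    rintro n k _ _ h rfl rfl
    exact h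
  by_cases e1 : 12 * k = n + 14
  · by_cases e2 : n = 34
    · exact key (realizable_of_familyCheck f1 0 0)
        (by simp [length_power, wordC, wordD]; omega) (by omega)
    · exact key (realizable_of_familyCheck f2 (k - 5) 0)
        (by simp [length_power, wordC, wordD]; omega) (by omega)
  by_cases e3 : 7 * k = n + 9
  · by_cases e2 : n = 40
    · exact key (realizable_of_familyCheck f3 0 0)
        (by simp [length_power, wordC, wordD]; omega) (by omega)
    · exact key (realizable_of_familyCheck f4 (k - 8) 0)
        (by simp [length_power, wordCD, wordC, wordD]; omega) (by omega)
  have main : ∀ e ∈ tails, ∀ j i, 7 * j + 12 * i + e.1.length = n → e.2 + j + i = k →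
      Realizable n k := by
    rintro e he j i rfl rfl
    by_cases hji : 4 ≤ j + 4 * i
    · exact realizable_CD he j i hji
    · have hi : i = 0 := by omega
      subst hi
      have : ∀ e ∈ tails, e.1.length ≤ 12 ∨ e = (power wordC 3 ++ power wordD 2, 3) := by
        decide
      rcases this e he with h | rfl
      · omega
      · obtain rfl : j = 3 := by
          simp [length_power, wordC, wordD] at hn
          omega
        exact key (realizable_of_familyCheck f5 0 0)
          (by simp [length_power, wordC, wordD, wordCD]) (by simp)
  obtain ⟨a, ha⟩ : ∃ a, 12 * k = n + 12 + a := ⟨12 * k - n - 12, by omega⟩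
  obtain ⟨b, hb⟩ : ∃ b, n + 11 = 7 * k + b := ⟨n + 11 - 7 * k, by omega⟩
  have hab : a + b + 1 = 5 * k := by omega
  have ha2 : a ≠ 2 := by omega
  have hb1 : b ≠ 1 := by omega
  have hb2 : b ≠ 2 := by omega
  have hk : 4 ≤ k := by omega
  have hcase : a % 5 = 0 ∧ 4 ≤ b ∨ a % 5 = 4 ∧ 9 ≤ a ∨ a % 5 = 4 ∧ a = 4 ∧ 5 ≤ b ∨
      a % 5 = 1 ∧ 6 ≤ a ∧ 3 ≤ b ∨ a % 5 = 1 ∧ a = 1 ∧ 8 ≤ b ∨ a % 5 = 3 ∧ 6 ≤ b ∨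
      a % 5 = 2 ∧ 7 ≤ a ∧ 7 ≤ b := by
    clear main e1 e3 ha hb hw hn
    have h5 : a % 5 < 5 := Nat.mod_lt _ (by norm_num)
    interval_cases h : a % 5 <;> simp <;> omega
  rcases hcase with h | h | h | h | h | h | h
  · exact main ([], 1) (by simp [tails]) (a / 5) ((b - 4) / 5)
      (by simp; omega) (by simp; omega)
  · exact main (wordC, 2) (by simp [tails]) ((a - 9) / 5) (b / 5)
      (by simp [wordC]; omega) (by simp; omega)
  · exact main (power wordD 2, 2) (by simp [tails]) 0 ((b - 5) / 5)
      (by simp [length_power, wordD]; omega) (by simp; omega)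
  · exact main (power wordC 2, 2) (by simp [tails]) ((a - 6) / 5) ((b - 3) / 5)
      (by simp [length_power, wordC]; omega) (by simp; omega)
  · exact main (wordC ++ power wordD 2, 2) (by simp [tails]) 0 ((b - 8) / 5)
      (by simp [length_power, wordC, wordD]; omega) (by simp; omega)
  · exact main (power wordC 3, 2) (by simp [tails]) ((a - 3) / 5) ((b - 6) / 5)
      (by simp [length_power, wordC]; omega) (by simp; omega)
  · exact main (power wordC 3 ++ power wordD 2, 3) (by simp [tails]) ((a - 7) / 5) ((b - 7) / 5)
      (by simp [length_power, wordC, wordD]; omega) (by simp; omega)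

/-! ### Certificates for the universal bounds -/

/-- Table proving the lower bound for words in the blocks `A` and `B`. -/
def lowerCertAB : ℕ → List (ℕ × ℕ)
  | 0 => [
      (462016522904572521, 3), (10550079679632675433, 3), (29670950095196777, 4),
      (462015913018132073, 4), (1326707040945607785, 4), (10387879723229418025, 4),
      (10550079679632901737, 4), (10685152492134896713, 4), (11586181767795241, 5),
      (20628574521562185, 5), (29670323020365929, 5), (153440224038490657, 5),
      (306597804868113473, 5), (434888760527029769, 5), (1317664708849963593, 5),
      (10387879714639351849, 5), (10396956740935747177, 5), (10694194875761824361, 5),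
      (2543196299462153, 6), (9325035962634785, 6), (11585554692964393, 6),
      (18367428716401729, 6), (20627938856665161, 6), (153440155317961249, 6),
      (290844533766623849, 6), (306597736147584065, 6), (462015911416991849, 6),
      (1297319344481636865, 6), (10378837330475651081, 6), (282651798934017, 7),
      (2543170529263625, 7), (9324958652039201, 7), (18367342815739969, 7),
      (288512967820182529, 7), (1317664707642262601, 7), (282574488338433, 8), (1746047561, 9),
      (432355461577478153, 9), (10520524180012793961, 9), (680694313, 10), (1217434633, 10),
      (1744867945, 10), (1745225321, 10), (432461014693707881, 10), (1297037793403470849, 10),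
      (10376338622118887977, 10), (10520408731291877376, 10), (10520453810194874409, 10),
      (10664604183179821129, 10), (134481409, 11), (538055201, 11), (671126057, 11),
      (680562729, 11), (1075057729, 11), (1207997513, 11), (1209143881, 11), (1744830569, 11),
      (1744867840, 11), (1746277888, 11), (144151472496579105, 11), (144160268723851305, 11),
      (288301845481525313, 11), (432345565972791296, 11), (432355459966828553, 11),
      (1297072977104470049, 11), (1297116958240669769, 11), (1441223350089416769, 11),
      (10376328725977367072, 11), (10376338622118887465, 11), (10520408730218135552, 11),
      (10664523918830993408, 11), (135712, 12), (1184257, 12), (134219273, 12), (143691785, 12),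
      (536875553, 12), (537002529, 12), (671088681, 12), (671126016, 12), (1073747009, 12),
      (1074005057, 12), (1207959625, 12), (1207997440, 12), (1217565184, 12), (1744830464, 12),
      (144150373119201312, 12), (144151472496574497, 12), (288300744896155712, 12),
      (288301845481521217, 12), (432345564362178560, 12), (1152992973937443905, 12),
      (1297036693220753408, 12), (1297036693891842048, 12), (1297037792195510273, 12),
      (1441151881833611264, 12), (10376293542142148608, 12), (10376303437209927689, 12),
      (4609, 13), (263169, 13), (134217737, 13), (134219264, 13), (143954944, 13),
      (536870945, 13), (536875520, 13), (671088640, 13), (1073741889, 13), (1073746944, 13),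
      (1207959552, 13), (144115188612857856, 13), (288230377225715712, 13),
      (288231475663601665, 13), (1152991874425816128, 13), (1297036692683882496, 13),
      (10376293541605277696, 13), (1, 14), (4608, 14), (394752, 14), (134217728, 14),
      (536870912, 14), (1073741824, 14), (288230376151973888, 14), (0, 15)]
  | 3 => [
      (1614937486228067945, 2), (10694194867591321193, 2), (29670417393653353, 3),
      (462016522787132009, 3), (1317664725912655433, 3), (1614937486236488809, 3),
      (10550079679515234921, 3), (10694194876181156969, 3), (20628033229952585, 4),
      (29670322902925417, 4), (290773572333733385, 4), (1317664708732523081, 4),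
      (1326707040828167273, 4), (10387879723111977513, 4), (10685152492017456201, 4),
      (2543196182021641, 5), (11586181650354729, 5), (20627938739224649, 5),
      (290773563743667209, 5), (10387879714521911337, 5), (10396956740818306665, 5),
      (2543170411823113, 6), (1627788905, 8), (155418176736330280, 8), (308575757565953096, 8),
      (1585382519184162921, 8), (9234675575279452712, 8), (9531948327005062216, 8),
      (10664604183599256137, 8), (1091966537, 9), (1627395689, 9), (1628607049, 9),
      (1637127273, 9), (11302988660474408, 9), (20345381414241352, 9), (146375792572629512, 9),
      (155418176744751144, 9), (155418717902242344, 9), (308576307321798728, 9),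
      (432355461460037641, 9), (1297116958123230281, 9), (1585267070463246336, 9),
      (1585347334275203145, 9), (9234675566689419304, 9), (9241421688456086017, 9),
      (9243717950853120072, 9), (10520524179895353449, 9), (10664639367971340393, 9),
      (17171977, 10), (563253801, 10), (1090524745, 10), (1091703369, 10), (1099994121, 10),
      (1627390057, 10), (1627395584, 10), (2260604496773640, 10), (11302980070408232, 10),
      (20345364234109000, 10), (155418176207880232, 10), (288240271773402633, 10),
      (288310641591325257, 10), (290490989238551560, 10), (432355459849388041, 10),
      (1297037793286030337, 10), (1297116958123229257, 10), (1585267069926375424, 10),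
      (9225633182525718536, 10), (10376338622001447465, 10), (10520408731174436864, 10),
      (10520453810077433897, 10), (10664523919250423808, 10), (10664604183062380617, 10),
      (16778761, 11), (17040393, 11), (17040897, 11), (553685545, 11), (563122217, 11),
      (1090519113, 11), (1090524672, 11), (1627389952, 11), (2260595906707464, 11),
      (144160268606410793, 11), (288231476754125313, 11), (288240271773401097, 11),
      (432345564244738048, 11), (1297036693774401536, 11), (10376328725859926560, 11),
      (10376338622001446953, 11), (10520408730100695040, 11), (10664523918713552896, 11),
      (16777225, 12), (16778752, 12), (553685504, 12), (1090519040, 12), (144150373001760800, 12),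
      (288230376168751104, 12), (10376293542024708096, 12), (16777216, 13), (537002536, 14),
      (1074005064, 14), (144159169077968936, 14), (288309542062915656, 14),
      (9223380833493058056, 14), (131592, 15), (536871464, 15), (545292328, 15), (1073742920, 15),
      (1073774664, 15), (144115188612857856, 15), (144123984169009160, 15),
      (288230377225715712, 15), (9223416017865146408, 15), (9223451202774106184, 15), (520, 16),
      (263176, 16), (8421384, 16), (536870952, 16), (536871424, 16), (1073741896, 16),
      (1073742848, 16), (144115188075986944, 16), (288239172244996104, 16),
      (9223372037400035328, 16), (9223372037936906240, 16), (9223380832956186632, 16), (8, 17),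
      (512, 17), (263168, 17), (536870912, 17), (1073741824, 17), (288230376151973888, 17),
      (9223372036863164416, 17), (0, 18)]
  | 5 => [
      (1614938035589650025, 0), (29670966755235433, 1), (1614937485825414761, 1),
      (10550079146536900201, 1), (29670322500272233, 2), (1234343529, 6), (155418726097912360, 6),
      (155701369323556905, 6), (1180049275045843040, 6), (1306361659405767201, 6),
      (1585382518781547625, 6), (10387879714119258153, 6), (10808754555644674153, 6),
      (1224775273, 7), (1226184297, 7), (9325035442541089, 7), (11303538022056488, 7),
      (11586172657635369, 7), (27127770438996064, 7), (144406575838302281, 7),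
      (153440154797867553, 7), (155418176333677096, 7), (1180048725281607776, 7),
      (1585382518781509737, 7), (10385336543573217312, 7), (10387879104233902633, 7),
      (10387879714119352873, 7), (10520524179492701801, 7), (10664639367568691817, 7),
      (10808639106923757568, 7), (1224736873, 8), (1224775168, 8), (9043002111594528, 8),
      (9324958131945505, 8), (11302979667755048, 8), (27127151954231392, 8),
      (153157580292751904, 8), (1585267070060593152, 8), (10387879713968357929, 8),
      (10664604183196602953, 8), (1224736768, 9), (9042383626829856, 9), (17961505, 12),
      (142770728, 12), (160469033, 12), (1083215968, 12), (144150372599107616, 12),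
      (144159168675348520, 12), (1153027058797940832, 12), (1297072976584376353, 12),
      (9367531205538480168, 12), (10376338621598793769, 12), (10376399095661068384, 12),
      (1085504, 13), (9474080, 13), (16777761, 13), (134251048, 13), (134349352, 13),
      (151031849, 13), (1073778784, 13), (1074794592, 13), (144123984169041928, 13),
      (144151471976480801, 13), (144159168675315752, 13), (1153027058797903968, 13),
      (1297036692700659712, 13), (9223416017462493736, 13), (9367487225073369088, 13),
      (10376293541622054912, 13), (10376293542544801792, 13), (10376328725843148832, 13),
      (36896, 14), (131616, 14), (16777249, 14), (16781824, 14), (134217768, 14), (134251008, 14),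
      (151031808, 14), (1073741920, 14), (1073778688, 14), (144115188092764160, 14),
      (144115188210204672, 14), (144150372448075808, 14), (1152921505681637376, 14),
      (9223380833090404872, 14), (10376293541471059968, 14), (32, 15), (36864, 15), (1184256, 15),
      (16777216, 15), (134217728, 15), (1073741824, 15), (144115188075986944, 15), (0, 16)]
  | 6 => [
      (10550079146000029289, 1), (29670966218364521, 2), (1614937485288543849, 2),
      (10550079678575710825, 2), (10694194866651797097, 2), (29670321963401321, 3),
      (1317664724973131337, 3), (10396922114926220361, 3), (20628032290428489, 4),
      (20628573464597577, 4), (1317664707792998985, 4), (1326707039888643177, 4),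
      (10396922097746088009, 4), (20627937799700553, 5), (697603689, 7), (306597735090619457, 7),
      (1171288932266280001, 7), (9243717417337914440, 7), (10403420761607934048, 7),
      (10520524178955830889, 7), (10808754555107803241, 7), (687904361, 8), (688264809, 8),
      (697471593, 8), (18367358938907713, 8), (20345930238952520, 8), (27127769902125152, 8),
      (306315160585503808, 8), (306597735091671105, 8), (306597786630231105, 8),
      (432461013636780137, 8), (1161929811972588553, 8), (1171288915086151745, 8),
      (1180048724744736864, 8), (1585382518244638825, 8), (9243717949913595976, 8),
      (9531948326065538120, 8), (10520524178955829353, 8), (10664604182659732041, 8),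
      (10808639106386886656, 8), (152442441, 9), (160732233, 9), (687865961, 9), (687904256, 9),
      (689082953, 9), (18084784433792064, 9), (18367341758775361, 9), (20345363294584904, 9),
      (27127151417360480, 9), (306597735074893889, 9), (432355460520513545, 9),
      (1171006340581036096, 9), (1297116957183706185, 9), (1585267069523722240, 9),
      (1585347333335679049, 9), (10376373805970920521, 9), (10520408730234912768, 9),
      (10664604182122856521, 9), (151000649, 10), (151032905, 10), (152179273, 10),
      (160469065, 10), (160470025, 10), (687865856, 10), (18084767253659712, 10),
      (288310640651801161, 10), (1297037792346506241, 10), (1297116957183705161, 10),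
      (1585267068986851328, 10), (10376373805970882633, 10), (10664523917774028800, 10),
      (150995017, 11), (151000576, 11), (151032832, 11), (288231475814601217, 11),
      (1297036692834877440, 11), (10376293541622054912, 11), (150994944, 12), (17040449, 13),
      (142902344, 13), (546345056, 13), (288301844424556609, 13), (1152991873368851520, 13),
      (9223451201834583112, 13), (9511681577986555976, 13), (10376399095124197472, 13),
      (263232, 14), (8389640, 14), (16778305, 14), (17829953, 14), (134251592, 14),
      (142639176, 14), (536875104, 14), (288230376168751104, 14), (288300744896151616, 14),
      (1152992972880478273, 14), (1153027058261033056, 14), (9223451201834582088, 14),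
      (9511602413149356032, 14), (10376293542007930880, 14), (1088, 15), (1052736, 15),
      (16777281, 15), (16778240, 15), (134217800, 15), (134251520, 15), (536871008, 15),
      (536907776, 15), (288230376151973888, 15), (1152921504624672768, 15),
      (1152921505144766464, 15), (1152991873352073280, 15), (9223372036997382144, 15), (64, 16),
      (1024, 16), (9474048, 16), (16777216, 16), (134217728, 16), (536870912, 16),
      (1152921504607895552, 16), (0, 17)]
  | _ => []

/-- Table proving the lower bound for words in the blocks `C` and `D`. -/
def lowerCertCD : ℕ → List (ℕ × ℕ)
  | 1 => [
      (1614938036126520425, 2), (10550079147073770601, 3), (462016522921349225, 5),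
      (10550079679649452137, 5), (10838309428736201833, 5), (29670967282275433, 7),
      (462015913034908777, 7), (10396956740952523881, 7), (29670323047011433, 8),
      (1326707093030441065, 8), (10550079052584226921, 8), (116092966048873, 10),
      (29670950102405225, 10), (434888760543806473, 10), (462015887265105001, 10),
      (10531994911322050601, 10), (10808754556181582953, 10), (115448720954473, 11),
      (29670323046748265, 11), (146658367211962377, 11), (1326707015721029737, 11),
      (29670348806947945, 12), (116075786178665, 13), (29670323037537385, 13),
      (29670400346558569, 13), (434888734774002697, 13), (10520524180029608041, 13),
      (10531994284256825385, 13), (10694194875778601065, 13), (1771213929, 14),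
      (115448720953449, 14), (29670323038326889, 14), (146658358622027785, 14),
      (155418726634782760, 14), (1306361659942637601, 14), (10808639749944153088, 14),
      (1761645673, 15), (115474490721385, 15), (2543196315845641, 15), (11586181775003689, 15),
      (153440155334737953, 15), (432461014710486121, 15), (9378790213733744680, 15),
      (10387879104770773033, 15), (10520524180029572201, 15), (80891414057065, 16),
      (115448720917609, 16), (115526030332009, 16), (2543170546435081, 16),
      (2543179135975433, 16), (2543788870730857, 16), (11585554719346729, 16),
      (288592192803704905, 16), (290773546563929097, 16), (1297152143166410857, 16),
      (10387879714505228329, 16), (10664604183733473353, 16), (1762824265, 17),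
      (115448720920681, 17), (282591669391433, 17), (2543170546171913, 17),
      (153440146729078817, 17), (155418718036459560, 17), (9378790205143810088, 17),
      (10520409356612308992, 17), (10808639105699058688, 17), (1761644649, 18),
      (9921374454793, 18), (45707042000937, 18), (153440146744803361, 18),
      (432355459983606793, 18), (10520453810211688489, 18), (9868393, 19), (151258113, 19),
      (644245132288, 19), (9895604651017, 19), (9904194584585, 19), (35261681500193, 19),
      (45079976775721, 19), (11303538550407208, 19), (144125083831631881, 19),
      (155418176870547496, 19), (432345589997765632, 19), (1297319344498413569, 19),
      (9225667825866113064, 19), (10376328725994143776, 19), (9868288, 20), (1761608809, 20),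
      (1762791529, 20), (9895604649993, 20), (9324958670000161, 20), (9324967258751009, 20),
      (11302980213178408, 20), (1297036769993297920, 20), (10520408729547083776, 20),
      (1761611881, 21), (9324958668947489, 21), (37993, 22), (9605225, 22), (697471017, 22),
      (1761645568, 22), (627065262080, 22), (44538810892328, 22), (144397771171037185, 22),
      (146375792706846728, 22), (153157580829622304, 22), (155418168280612904, 22),
      (432345564227961856, 22), (1297072977121251361, 22), (1297319267189002241, 22),
      (9367531206075383848, 22), (37888, 23), (9605120, 23), (150995977, 23), (151126025, 23),
      (687902761, 23), (36283883720737, 23), (36292473651233, 23), (43980465143848, 23),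
      (144115196665921536, 23), (144151472513351713, 23), (1297036692683886592, 23), (394345, 24),
      (150994953, 24), (25769804800, 24), (36283883716641, 24), (282651814531073, 24),
      (11302988794560552, 24), (36969, 25), (394240, 25), (1183817, 25), (1761644544, 25),
      (77309415424, 25), (282574489522177, 25), (9043002102251561, 25), (11302980204757032, 25),
      (144397762581102593, 25), (146375784116912136, 25), (153157572239687712, 25),
      (288231476888342529, 25), (9234675566286864424, 25), (36864, 26), (1183744, 26),
      (679641128, 26), (144115188075986944, 26), (1129, 27), (150995968, 27), (553648161, 27),
      (671121448, 27), (35192962023456, 27), (282583095050241, 27), (2260604630859784, 27),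
      (1024, 28), (4201, 28), (131081, 28), (131104, 28), (16781312, 28), (8589934592, 28),
      (1099511631873, 28), (43980465111080, 28), (282574505246721, 28), (2260595906838536, 28),
      (9223380833627275272, 28), (4096, 29), (131072, 29), (1, 31), (134217728, 31),
      (8796093022216, 31), (35184372088864, 31), (0, 32)]
  | 2 => [
      (10838310072981295721, 1), (1614938036126519913, 2), (1614937486362284649, 4),
      (10694194867725537897, 4), (10838309428736201321, 4), (29670967282274921, 6),
      (1326707040962383977, 6), (10694194876315373673, 6), (29670323047010921, 7),
      (462015913034908265, 7), (1614937391873004137, 7), (10396956740952523369, 7),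
      (116092966048361, 9), (29670417526428265, 9), (1605895102198583881, 9),
      (10685152492151672905, 9), (10694194240660213865, 9), (10808754556181582441, 9),
      (115448720953961, 10), (29670323038589545, 10), (308858332205285449, 10),
      (462015887265104489, 10), (29670958692339817, 11), (115543210201705, 12),
      (29670323046879337, 12), (29670348806947433, 12), (1585382519318385257, 12),
      (1605895007709303369, 12), (10685151856496513097, 12), (1763086953, 13),
      (115448720921193, 13), (29670323037536873, 13), (306597804884889665, 13),
      (308858315025416265, 13), (434888751953871369, 13), (9531948344319180872, 13),
      (10808639749944152576, 13), (1761645161, 14), (116084376113257, 14),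
      (20628033362727497, 14), (20628574528639049, 14), (290773563877883913, 14),
      (308576307464405064, 14), (1317664648737198665, 14), (1459519240772259905, 14),
      (1585382519318417513, 14), (10664639368105594985, 14), (115448720953449, 15),
      (115474490720873, 15), (20627938874888777, 15), (20627938883178569, 15),
      (20627956053311561, 15), (20628014967853161, 15), (432461014710485609, 15),
      (1317664707659038793, 15), (10396921479271059529, 15), (10520524180029571689, 15),
      (1762005609, 16), (115448720917097, 16), (2543788870730345, 16), (20627938873704521, 16),
      (290773546563928585, 16), (306597787703971905, 16), (308575757700169800, 16),
      (1459519223592390721, 16), (1585267163325141504, 16), (9531947777383497800, 16),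
      (9531948327139278920, 16), (10808639105699058176, 16), (1761612393, 17),
      (80358838112841, 17), (80900004024393, 17), (290773546698014729, 17),
      (1585347334409425481, 17), (10664604183196635209, 17), (9867881, 18), (1234210825, 18),
      (644245131776, 18), (1125281431561, 18), (80264348832329, 18), (80264348864585, 18),
      (80281528696905, 18), (18367428731867201, 18), (20345381556617288, 18),
      (20345931304042568, 18), (288310641725538377, 18), (306597736164360257, 18),
      (1171007389626794049, 18), (1297037793420247041, 18), (10664524553278230528, 18),
      (9867776, 19), (151257601, 19), (1761644649, 19), (80264348827721, 19),
      (2543187725910025, 19), (18084835973398593, 19), (18367342833832001, 19),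
      (20345364377010248, 19), (308575740520300616, 19), (432345589997765120, 19),
      (1585267068835860992, 19), (9243717400158011464, 19), (1761608297, 20),
      (2543170546302985, 20), (37481, 21), (1446505, 21), (1761645056, 21), (94489285120, 21),
      (71554155155521, 21), (79731772915784, 21), (20345381548195912, 21),
      (288512967836958721, 21), (306315161659244608, 21), (306597718984491073, 21),
      (1441223350106198081, 21), (9511681579060330568, 21), (10664523917623070720, 21),
      (37376, 22), (1446400, 22), (1224741449, 22), (1224773705, 22), (1224998985, 22),
      (9895604650505, 22), (9912784519177, 22), (71468255809601, 22), (79164837232712, 22),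
      (20345364368588872, 22), (288230393331843072, 22), (288240271907618825, 22),
      (432345564227961344, 22), (9736297, 23), (1224736841, 23), (635655196672, 23),
      (9895604649993, 23), (18367360012386369, 23), (4713, 24), (393833, 24), (9736192, 24),
      (1761612288, 24), (25769804288, 24), (79182017069128, 24), (282651798011977, 24),
      (18367342832779329, 24), (288309542197133384, 24), (288512950657089537, 24),
      (306315144479375424, 24), (4608, 25), (393728, 25), (1091833921, 25), (1208254536, 25),
      (79164837199944, 25), (288230376151973888, 25), (36969, 26), (150994953, 26),
      (1090523201, 26), (1207992392, 26), (1224773632, 26), (1116691496961, 26),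
      (18084785507270720, 26), (617, 27), (36864, 27), (262145, 27), (150995456, 27),
      (17179869184, 27), (71468255805505, 27), (18084767253921856, 27), (1152991874442592320, 27),
      (512, 28), (262144, 28), (1207959624, 29), (9, 30), (1073741824, 30), (1099511627777, 30),
      (70368744177728, 30), (0, 31)]
  | 4 => [
      (10550079147073767017, 3), (1614937486362281577, 4), (10694194867725534825, 4),
      (1326707040962380905, 6), (10694194876315370601, 6), (10838309428736198249, 6),
      (1614937391873001065, 7), (29670967282271849, 8), (1326707093030437481, 8),
      (29670323047007849, 9), (29670417526425193, 9), (10405964482983526505, 9),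
      (10694194240660210793, 9), (29670323038586473, 10), (116092966045289, 11),
      (29670958692336745, 11), (1306361728662110753, 11), (1317664726046869065, 11),
      (1326707015721026153, 11), (1459519309491733569, 11), (10808754556181579369, 11),
      (115448720950889, 12), (115543210198633, 12), (29670323046876265, 12),
      (1153204147832487937, 12), (1585382519318382185, 12), (10405963864508235881, 12),
      (115448720918121, 13), (29670400346554985, 13), (116084376110185, 14),
      (29670323038323305, 14), (29670941512466537, 14), (462015911433764969, 14),
      (1306361651352699425, 14), (1317664648737195593, 14), (1459519223592387649, 14),
      (1585382519318414441, 14), (10664639368105591913, 14), (1771341417, 15),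
      (115448720950377, 15), (20628014967850089, 15), (29670323046613097, 15),
      (1153204079113011201, 15), (10403420762681671776, 15), (10808639749944149504, 15),
      (1761642089, 16), (1762002537, 16), (80891414053481, 16), (115526030328425, 16),
      (9325035978228257, 16), (18367428731864129, 16), (288592192803701321, 16),
      (306597787703968833, 16), (1180048725818474592, 16), (1297152143166407273, 16),
      (1585267163325138432, 16), (10664604183733469769, 16), (1761609321, 17),
      (10531259842633, 17), (115448720917097, 17), (116067196239977, 17), (282591669387849, 17),
      (282643224592385, 17), (9324958669996577, 17), (18367342833828929, 17),
      (153168086319661097, 17), (153440146729075233, 17), (306597736148631617, 17),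
      (432355461594251273, 17), (10376408991953617001, 17), (1234207753, 18),
      (115448720949353, 18), (282574506164225, 18), (9042392226234409, 18),
      (1180048656570548320, 18), (10664524553278227456, 18), (10808639105699055104, 18),
      (1761641577, 19), (36361193128481, 19), (71554155152449, 19), (1180048657098997856, 19),
      (1297072977121247777, 19), (1441223350106195009, 19), (1585267068835857920, 19),
      (9864809, 20), (1762787945, 20), (644245128704, 20), (1168231104513, 20),
      (36283883717153, 20), (71468255806529, 20), (27127770966425696, 20),
      (1152922604136300545, 20), (1297036769993294336, 20), (10385336544110084128, 20),
      (1443433, 21), (9864704, 21), (1761608297, 21), (1771077737, 21), (94489282048, 21),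
      (1099511627777, 21), (27127152500572256, 21), (27127221210579040, 21),
      (10376294159946383360, 21), (10664523917623067648, 21), (1443328, 22), (1761640553, 22),
      (27127152492150880, 22), (34409, 23), (9733225, 23), (554828321, 23), (1091830849, 23),
      (1761641984, 23), (635655193600, 23), (106171591589984, 23), (1161963957491073056, 23),
      (1171006341654773824, 23), (1297036692683883008, 23), (1441151966659216384, 23),
      (10376399096197972064, 23), (10385335925634793504, 23), (1641, 24), (34304, 24),
      (9733120, 24), (17825793, 24), (553648673, 24), (1090520129, 24), (1761609216, 24),
      (105553116299360, 24), (105621835743328, 24), (1152921573327372288, 24),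
      (1153027059334774880, 24), (10376293541471092736, 24), (1536, 25), (1180233, 25),
      (16777217, 25), (77309411840, 25), (105553116266592, 25), (9043002639024160, 25),
      (33897, 26), (1180160, 26), (9469961, 26), (1224770560, 26), (618475323392, 26),
      (9042383636299808, 26), (18084784434577473, 26), (144150373135974432, 26),
      (1161963888771596320, 26), (1171006272935297088, 26), (1441151880759870464, 26),
      (33792, 27), (9469952, 27), (1152921504607895552, 27), (617, 28), (1311809, 28),
      (16777728, 28), (1090782272, 28), (1610612832, 28), (85899346944, 28), (70437463654464, 28),
      (9042452883177504, 28), (288300745986670656, 28), (512, 29), (32841, 29), (1048577, 29),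
      (1048640, 29), (1311744, 29), (536903680, 29), (68719476736, 29), (35184372121632, 29),
      (9042384164749344, 29), (32768, 30), (1048576, 30), (1089, 31), (1090520064, 31), (1, 32),
      (1024, 32), (16777216, 32), (35184372088864, 32), (70368744177728, 32), (0, 33)]
  | 7 => [
      (10838310072981263977, 0), (10550079147073738345, 3), (10838309428736169577, 3),
      (29670967282243177, 5), (462016522921316969, 5), (10550079679649419881, 5),
      (29670323046979177, 6), (1326707040962352233, 6), (10694194876315341929, 6),
      (116092966016617, 8), (10550079052584194665, 8), (10808754556181550697, 8),
      (115448720922217, 9), (10405964482983497833, 9), (10694194240660182121, 9),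
      (29670950102372969, 10), (29670323046716009, 11), (29670958692308073, 11), (1771443817, 12),
      (29670323046847593, 12), (9378790763489526312, 12), (9531948344319149128, 12),
      (10387879723246162473, 12), (10403421312437456992, 12), (10405963864508207209, 12),
      (10685152474971771977, 12), (10808639749944120832, 12), (1761613417, 13),
      (116075786146409, 13), (10396922098819797065, 13), (10520524180029575785, 13),
      (10531994902732083753, 13), (115448720921193, 14), (116084376081513, 14),
      (29670941512437865, 14), (462015911433736297, 14), (1585382519318385769, 14),
      (10664639368105563241, 14), (115448720921705, 15), (20628014967821417, 15),
      (29670323046584425, 15), (9243717418411623496, 15), (9378790205143777832, 15),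
      (9531947777383466056, 15), (10387879104770740777, 15), (10396921479271027785, 15),
      (10403420693962166368, 15), (10808639105699026432, 15), (10396921480344506441, 16),
      (9836137, 17), (1762792009, 17), (644245100032, 17), (10531259813961, 17),
      (116067196211305, 17), (11303538550374952, 17), (20345931304010824, 17),
      (27127770966397024, 17), (153168086319632425, 17), (155418718036427304, 17),
      (308576307455983688, 17), (432355461594222601, 17), (9243717950987305032, 17),
      (10376408991953588329, 17), (10387879714656096297, 17), (10520409356612276736, 17),
      (9836032, 18), (1234179081, 18), (1761612393, 18), (115448720920681, 18),
      (9042392226205737, 18), (11302980213146152, 18), (20345364376978504, 18),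
      (20345381556585544, 18), (20628557348737097, 18), (27127152500543584, 18),
      (155418176342065192, 18), (1180048656570519648, 18), (9234675566823604264, 18),
      (10664524553278198784, 18), (1761612905, 19), (20627938882883657, 19), (5737, 20),
      (1761613312, 20), (44538810860072, 20), (79731772884040, 20), (106171591561312, 20),
      (9243717401231491144, 20), (9367531206075351592, 20), (9511681579060298824, 20),
      (10376399096197943392, 20), (10378837330492395529, 20), (10385336544110055456, 20),
      (10387879096180805673, 20), (10520408729547051520, 20), (5632, 21), (1771049065, 21),
      (43980465111592, 21), (79164837200968, 21), (80882824122441, 21), (105553116270688, 21),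
      (9234675017067790376, 21), (10376294159946354688, 21), (10376373807044628553, 21),
      (10664523917623038976, 21), (9572969, 22), (1761611881, 22), (627065229824, 22),
      (80264348831817, 22), (11586173185036329, 22), (20345914124140616, 22), (9572864, 23),
      (9704553, 23), (635655164928, 23), (2543196174291049, 23), (11303529960439848, 23),
      (11585554719182889, 23), (20345364376715336, 23), (10378836712017104905, 23),
      (10385335925634764832, 23), (9704448, 24), (679608872, 24), (1216611400, 24),
      (1620054112, 24), (11302980213014568, 24), (9225633182659903496, 24),
      (9232414970782679072, 24), (9241457354946379840, 24), (9367487783284900352, 24),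
      (9511602979950822400, 24), (10376293541471064064, 24), (4713, 25), (671089192, 25),
      (1207960648, 25), (1224740937, 25), (1610616928, 25), (1761612288, 25),
      (10514079944713, 25), (79714593013832, 25), (9043002638995488, 25),
      (9223451202908323912, 25), (4608, 26), (5225, 26), (9441289, 26), (1224741888, 26),
      (618475294720, 26), (44530220924968, 26), (45079976742953, 26), (79164837199944, 26),
      (9042383636271136, 26), (144150373135945760, 26), (144159169212186664, 26),
      (9223416017999364136, 26), (5120, 27), (9441280, 27), (43980465111080, 27),
      (2260604505030696, 27), (9225632632904089608, 27), (9232414421026865184, 27),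
      (9241456805190565952, 27), (9367487224939151872, 27), (9511602413015139328, 27), (4169, 29),
      (8520232, 29), (8651848, 29), (536875008, 29), (671220232, 29), (1207959624, 29),
      (558345748992, 29), (566935684096, 29), (9345848836104, 29), (9895604654089, 29),
      (35184372092960, 29), (9042933919514656, 29), (18085318083215424, 29),
      (144123984840097800, 29), (288239173452955656, 29), (9223372586618978304, 29), (4096, 30),
      (8388616, 30), (8520192, 30), (8651776, 30), (9042383635218464, 30),
      (18084768335790144, 30), (671088680, 31), (552, 32), (1096, 32), (671089152, 32),
      (1207960576, 32), (35734127902752, 32), (70918499991616, 32), (9223372036863164416, 32),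
      (512, 33), (1024, 33), (8796093022216, 33), (35184372088864, 33), (70368744177728, 33),
      (0, 34)]
  | _ => []

/-- Tables proving the upper bound for words in the blocks `A` and `B`. -/
def upperCertAB : List (ℕ × List (ℕ × ℕ)) := [
    (0, [
      (9437288, 4), (8, 8)]),
    (3, [
      (9437281, 4), (1, 8)]),
    (6, [
      (9437225, 4), (0, 8)]),
    (5, [
      (9437257, 4), (0, 8)]),
    (0, [
      (0, 7)]),
    (3, [
      (1179745, 3), (64, 7)]),
    (6, [
      (1179689, 3), (8, 7)]),
    (5, [
      (1179721, 3), (0, 7)]),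
    (0, [
      (8, 6), (0, 10)]),
    (3, [
      (1, 6), (0, 10)]),
    (6, [
      (32, 6), (262152, 6)]),
    (5, [
      (64, 6), (131080, 6)]),
    (0, [
      (72, 5), (0, 9)]),
    (3, [
      (65, 5), (0, 9)]),
    (6, [
      (9, 5), (0, 9)]),
    (5, [
      (1, 5), (9437248, 5)]),
    (0, [
      (32, 5), (262208, 5)]),
    (0, [
      (1179680, 4)]),
    (3, [
      (393217, 3), (131072, 7)]),
    (6, [
      (262144, 6)]),
    (5, [
      (9437184, 5), (8388608, 9)])]

/-- Tables proving the upper bound for words in the blocks `C` and `D`. -/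
def upperCertCD : List (ℕ × List (ℕ × ℕ)) := [
    (2, [
      (73, 10), (64, 17)]),
    (4, [
      (8388713, 9), (1, 16), (8388640, 16)]),
    (7, [
      (1048681, 9), (40, 16), (72, 16), (1048608, 16)]),
    (1, [
      (1048681, 8), (9, 15), (40, 15), (1048577, 15)]),
    (4, [
      (131177, 8), (65, 15), (96, 15), (131073, 15)]),
    (2, [
      (131177, 7), (65, 14), (72, 14), (131081, 14)]),
    (1, [
      (262249, 7), (33, 14), (40, 14), (262153, 14)]),
    (4, [
      (8650857, 6), (1, 13), (8388704, 13)]),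
    (7, [
      (1310825, 6), (40, 13), (262216, 13), (1048672, 13)]),
    (2, [
      (9437289, 6), (9, 13), (65, 13), (8388680, 13)]),
    (1, [
      (9437289, 5), (9, 12), (1048609, 12), (8388648, 12)]),
    (4, [
      (65, 12), (131105, 12)]),
    (7, [
      (1179753, 5), (72, 12), (131112, 12), (1048617, 12), (1048672, 12)]),
    (1, [
      (41, 11), (262153, 11), (8, 18)]),
    (4, [
      (393321, 4), (96, 11), (131105, 11), (131145, 11), (262209, 11)]),
    (7, [
      (1441897, 3), (131112, 10), (262216, 10), (1048672, 10), (8, 17)]),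
    (1, [
      (9699433, 3), (33, 10), (262153, 10), (8388648, 10), (8, 17)]),
    (4, [
      (131105, 9), (262209, 9), (64, 16)]),
    (1, [
      (262153, 8), (9437225, 8), (8, 15), (32, 15)]),
    (2, [
      (1179721, 7), (9437257, 7), (1, 14), (64, 14)]),
    (4, [
      (131105, 7), (262209, 7), (64, 14)]),
    (4, [
      (8781929, 6), (1, 13), (8388640, 13)]),
    (7, [
      (1179753, 6), (72, 13), (131112, 13), (1048585, 13), (1048608, 13)]),
    (1, [
      (262153, 6), (9437225, 6), (8, 13), (32, 13)]),
    (1, [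
      (9699433, 5), (9, 12), (1048577, 12), (8388648, 12)]),
    (4, [
      (393321, 5), (96, 12), (131073, 12), (262209, 12)]),
    (2, [
      (1179721, 5), (9437257, 5), (1, 12), (64, 12)]),
    (2, [
      (9568361, 4), (73, 11), (131081, 11), (1048641, 11), (8388680, 11)]),
    (4, [
      (8781929, 4), (1, 11), (8388640, 11), (0, 18)]),
    (7, [
      (1179753, 4), (72, 11), (131112, 11), (1048585, 11), (1048608, 11)]),
    (1, [
      (9699433, 3), (9, 10), (1048577, 10), (8388648, 10), (0, 17)]),
    (4, [
      (393321, 3), (96, 10), (131073, 10), (262209, 10)]),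
    (2, [
      (9568361, 2), (73, 9), (131081, 9), (1048641, 9), (8388680, 9)]),
    (7, [
      (131112, 8), (262216, 8), (1048672, 8), (8, 15), (32, 15)]),
    (4, [
      (65, 10), (131105, 10)]),
    (1, [
      (41, 9), (262153, 9), (8, 16)]),
    (2, [
      (73, 8), (64, 15)]),
    (4, [
      (8388713, 7), (1, 14), (8388640, 14)]),
    (7, [
      (1048681, 7), (40, 14), (72, 14), (1048608, 14)]),
    (1, [
      (1048681, 6), (9, 13), (40, 13), (1048577, 13)]),
    (4, [
      (131177, 6), (65, 13), (96, 13), (131073, 13)]),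
    (2, [
      (131177, 5), (65, 12), (72, 12), (131081, 12)]),
    (1, [
      (262249, 5), (33, 12), (40, 12), (262153, 12)]),
    (4, [
      (8650857, 4), (1, 11), (8388704, 11), (0, 18)]),
    (7, [
      (1310825, 4), (40, 11), (262216, 11), (1048672, 11), (8, 18)]),
    (1, [
      (9437289, 3), (9, 10), (1048609, 10), (8388648, 10), (0, 17)])]

theorem lowerInit_AB : lowerInit 3 6 lowerCertAB 0 3 (initRel 3) 9 = true := by decide +kernel

theorem lowerStep_AB : lowerStep 3 6 lowerCertAB = true := by decide +kernel

theorem lowerFinal_AB : lowerFinal 3 11 lowerCertAB = true := by decide +kernel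

theorem lowerInit_CD : lowerInit 1 12 lowerCertCD 4 1 (initRel 1) 11 = true := by decide +kernel

theorem lowerStep_CD : lowerStep 1 12 lowerCertCD = true := by decide +kernel

theorem lowerFinal_CD : lowerFinal 1 23 lowerCertCD = true := by decide +kernel

theorem upperInit_AB : upperInit 0 4 upperCertAB 3 0
    (expand 0 4 1 0 0 (colMask 0 0) [(initRel 0, 4)]) = true := by decide +kernel

theorem upperStep_AB : upperStep 0 4 upperCertAB = true := by decide +kernel

theorem upperFinal_AB : upperFinal 0 (fun v => Nat.ble v 7) upperCertAB = true := by
  decide +kernel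

theorem upperInit_CD : upperInit 2 7 upperCertCD 0 4
    (expand 2 7 1 2 4 (colMask 2 4) [(initRel 2, 6)]) = true := by decide +kernel

theorem upperStep_CD : upperStep 2 7 upperCertCD = true := by decide +kernel

theorem upperFinal_CD : upperFinal 2 (fun v => Nat.ble v 15 || Nat.beq v 17) upperCertCD = true := by
  decide +kernel

/-! ### Universal bounds -/

theorem lower_bound_AB {n : ℕ} {σ T : ℕ → ℕ} (hF : Forces n σ T) (hσ : σ n = σ 0) (hq : σ 0 = 3)
    (hn : 0 < n) : n + 2 ≤ 6 * cost T n := by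
  have := lower_bound lowerInit_AB lowerStep_AB lowerFinal_AB hF hσ hq hn
  omega

theorem lower_bound_CD {n : ℕ} {σ T : ℕ → ℕ} (hF : Forces n σ T) (hσ : σ n = σ 0) (hq : σ 0 = 1)
    (hn : 4 < n) : n + 12 ≤ 12 * cost T n := by
  have := lower_bound lowerInit_CD lowerStep_CD lowerFinal_CD hF hσ hq hn
  omega

theorem upper_bound_AB {n : ℕ} {σ : ℕ → ℕ} (htr : ∀ i < n, Tr (σ i) (σ (i + 1)))
    (hσ : σ n = σ 0) (h0 : σ 0 = 0) (h1 : σ 1 = 0) (hn : 4 ≤ n) :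
    ∃ T, Forces n σ T ∧ cost T n ≤ (n + 3) / 4 := by
  obtain ⟨T, z, v, hF, hz, hv, he⟩ :=
    upper_bound upperInit_AB upperStep_AB upperFinal_AB htr hσ h0 h1 hn
  have := Nat.le_of_ble_eq_true hv
  exact ⟨T, hF, by omega⟩

theorem upper_bound_CD {n : ℕ} {σ : ℕ → ℕ} (htr : ∀ i < n, Tr (σ i) (σ (i + 1)))
    (hσ : σ n = σ 0) (h0 : σ 0 = 2) (h1 : σ 1 = 4) (hn : 1 ≤ n) :
    ∃ T, Forces n σ T ∧ cost T n ≤ (n + 9) / 7 + if n % 7 = 3 then 1 else 0 := by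
  obtain ⟨T, z, v, hF, hz, hv, he⟩ :=
    upper_bound upperInit_CD upperStep_CD upperFinal_CD htr hσ h0 h1 hn
  refine ⟨T, hF, ?_⟩
  rw [Bool.or_eq_true, natBeq_eq_decide, decide_eq_true_eq] at hv
  have hv : v ≤ 15 ∨ v = 17 := hv.imp_left Nat.le_of_ble_eq_true
  split_ifs <;> omega

/-! ### Words consisting of a single block -/

theorem power_add (w : List ℕ) (a b : ℕ) : power w (a + b) = power w a ++ power w b := by
  induction a with
  | zero => rw [Nat.zero_add]; rfl
  | succ a ih => rw [Nat.succ_add, power, power, ih, List.append_assoc]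

theorem power_mul (w : List ℕ) (b j : ℕ) : power w (b * j) = power (power w b) j := by
  induction j with
  | zero => rfl
  | succ j ih => rw [Nat.mul_succ, add_comm, power_add, ih, power]

theorem follows_power {s : ℕ → ℕ} {q : ℕ} {w : List ℕ} (hw : ∀ k, s k = q → Follows s k w)
    (hlast : w.getLastD q = q) (N : ℕ) {k : ℕ} (hk : s k = q) :
    Follows s k (power w N) ∧ s (k + (power w N).length) = q := by
  induction N generalizing k with
  | zero => exact ⟨trivial, hk⟩
  | succ N ih =>
    have h1 := hw k hk
    have h2 := ih (h1.getLast.trans (by rw [hk, hlast]))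
    rw [power, follows_append, List.length_append, ← add_assoc]
    exact ⟨⟨h1, h2.1⟩, h2.2⟩

theorem exact_of_block {q a b c δ v : ℕ} {w : List ℕ} {s : ℕ → ℕ}
    (h : familyCheck q (power w a) (power w b) δ [] [] 0 (power w c) v = true) (h8 : q < 8)
    (hw : ∀ k, s k = q → Follows s k w) (hlast : w.getLastD q = q) (h0 : s 0 = q)
    (hpos : 0 < w.length * c) (j : ℕ) :
    Exact (w.length * (a + (b * j + c))) s (v + δ * j) := by
  have e : power w (a + (b * j + c)) =
      power w a ++ (power (power w b) j ++ ([] ++ (power [] 0 ++ power w c))) := by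
    rw [power_add, power_add, power_mul]
    rfl
  obtain ⟨h1, h2⟩ := follows_power hw hlast (a + (b * j + c)) h0
  rw [zero_add] at h2
  have h3 := h2.trans h0.symm
  rw [e] at h1 h3
  have := exact_of_familyCheck h h8 h0 h1 (by rwa [length_power]) h3
  rwa [← e, length_power, zero_mul, add_zero] at this

theorem block_checks :
    (∀ s ∈ [1, 2, 3, 4], familyCheck 0 (power [0] 8) (power [0] 4) 1 [] [] 0 (power [0] s) 3 = true) ∧
    familyCheck 0 (power wordA 4) (power wordA 1) 1 [] [] 0 (power wordA 1) 5 = true ∧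
    familyCheck 1 (power wordD 7) (power wordD 2) 1 [] [] 0 (power wordD 1) 5 = true ∧
    familyCheck 1 (power wordD 7) (power wordD 2) 1 [] [] 0 (power wordD 2) 6 = true := by
  decide +kernel

theorem Exact.unique {n k l : ℕ} {s : ℕ → ℕ} (hk : Exact n s k) (hl : Exact n s l) : k = l := by
  obtain ⟨⟨T, hT, rfl⟩, h1⟩ := hk
  obtain ⟨⟨T', hT', rfl⟩, h2⟩ := hl
  exact le_antisymm (h1 _ hT') (h2 _ hT)

/-! ### Values of closed sequences -/

theorem transitions_cases {x y : ℕ} (h : Tr x y) :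
    x = 0 ∧ (y = 3 ∨ y = 0) ∨ x = 1 ∧ y = 2 ∨ x = 2 ∧ (y = 4 ∨ y = 7) ∨ x = 3 ∧ y = 6 ∨
      x = 4 ∧ y = 1 ∨ x = 5 ∧ y = 0 ∨ x = 6 ∧ y = 5 ∨ x = 7 ∧ y = 4 := by
  have key : ∀ e ∈ transitions, (e.1 = 0 ∧ (e.2.1 = 3 ∨ e.2.1 = 0) ∨ e.1 = 1 ∧ e.2.1 = 2 ∨
      e.1 = 2 ∧ (e.2.1 = 4 ∨ e.2.1 = 7) ∨ e.1 = 3 ∧ e.2.1 = 6 ∨ e.1 = 4 ∧ e.2.1 = 1 ∨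
      e.1 = 5 ∧ e.2.1 = 0 ∨ e.1 = 6 ∧ e.2.1 = 5 ∨ e.1 = 7 ∧ e.2.1 = 4) := by decide
  exact key _ h

theorem zero_tr_zero : Tr 0 0 := by
  unfold Tr
  decide

theorem exact_all_B {n k : ℕ} {s : ℕ → ℕ} (hs : ∀ i, s i = 0) (hn : 34 ≤ n)
    (hk : Exact n s k) : k = (n + 3) / 4 := by
  have h := exact_of_block (s := s) (block_checks.1 ((n - 9) % 4 + 1) (by
    have : (n - 9) % 4 < 4 := Nat.mod_lt _ (by norm_num)
    interval_cases (n - 9) % 4 <;> simp)) (by norm_num)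
    (fun k _ => ⟨by rw [hs]; exact zero_tr_zero, hs _, trivial⟩) rfl (hs 0) (by simp) ((n - 9) / 4)
  have e : [0].length * (8 + (4 * ((n - 9) / 4) + ((n - 9) % 4 + 1))) = n := by
    simp only [List.length_singleton]
    omega
  rw [e] at h
  rw [hk.unique h]
  omega

theorem exact_all_A {n k : ℕ} {s : ℕ → ℕ} (hs : ∀ i, Tr (s i) (s (i + 1)))
    (h0 : s 0 = 0) (hno : ∀ i, ¬ (s i = 0 ∧ s (i + 1) = 0)) (hn : 34 ≤ n) (hc : s n = s 0)
    (hk : Exact n s k) : k ≤ (n + 3) / 4 := by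
  have hw : ∀ k, s k = 0 → Follows s k wordA := by
    intro k hk
    have t0 := hs k
    have t1 := hs (k + 1)
    have t2 := hs (k + 1 + 1)
    have t3 := hs (k + 1 + 1 + 1)
    have c0 := transitions_cases t0
    have c1 := transitions_cases t1
    have c2 := transitions_cases t2
    have c3 := transitions_cases t3
    have := hno k
    have e1 : s (k + 1) = 3 := by omega
    have e2 : s (k + 1 + 1) = 6 := by omega
    have e3 : s (k + 1 + 1 + 1) = 5 := by omega
    have e4 : s (k + 1 + 1 + 1 + 1) = 0 := by omega
    exact ⟨e1 ▸ t0, e1, e2 ▸ t1, e2, e3 ▸ t2, e3, e4.subst (motive := Tr _) t3, e4, trivial⟩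
  have hmod : n = 4 * (n / 4) := by
    have := (follows_power hw rfl (n / 4) h0).2
    rw [length_power, zero_add] at this
    obtain ⟨-, e1, -, e2, -, e3, -⟩ := hw _ this
    have hl : wordA.length = 4 := rfl
    rw [hl] at e1 e2 e3
    have hr : n % 4 < 4 := Nat.mod_lt _ (by norm_num)
    have hd := Nat.div_add_mod n 4
    rw [h0, ← hd] at hc
    interval_cases n % 4
    · omega
    · rw [e1] at hc; omega
    · rw [show 4 * (n / 4) + 2 = 4 * (n / 4) + 1 + 1 from rfl, e2] at hc; omega
    · rw [show 4 * (n / 4) + 3 = 4 * (n / 4) + 1 + 1 + 1 from rfl, e3] at hc; omega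
  have h := exact_of_block block_checks.2.1 (by norm_num) hw rfl h0 (by simp [wordA]) (n / 4 - 5)
  rw [show wordA.length * (4 + (1 * (n / 4 - 5) + 1)) = n by
    rw [show wordA.length = 4 from rfl]; omega] at h
  rw [hk.unique h]
  omega

theorem exact_all_D {n k : ℕ} {s : ℕ → ℕ} (hs : ∀ i, Tr (s i) (s (i + 1)))
    (h0 : s 0 = 1) (hno : ∀ i, ¬ (s i = 2 ∧ s (i + 1) = 4)) (hn : 34 ≤ n) (hc : s n = s 0)
    (hk : Exact n s k) : k ≤ (n + 9) / 7 := by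
  have hw : ∀ k, s k = 1 → Follows s k wordD := by
    intro k hk
    have t0 := hs k
    have t1 := hs (k + 1)
    have t2 := hs (k + 1 + 1)
    have t3 := hs (k + 1 + 1 + 1)
    have c0 := transitions_cases t0
    have c1 := transitions_cases t1
    have c2 := transitions_cases t2
    have c3 := transitions_cases t3
    have := hno (k + 1)
    have e1 : s (k + 1) = 2 := by omega
    have e2 : s (k + 1 + 1) = 7 := by omega
    have e3 : s (k + 1 + 1 + 1) = 4 := by omega
    have e4 : s (k + 1 + 1 + 1 + 1) = 1 := by omega
    exact ⟨e1 ▸ t0, e1, e2 ▸ t1, e2, e3 ▸ t2, e3, e4.subst (motive := Tr _) t3, e4, trivial⟩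
  have hmod : n = 4 * (n / 4) := by
    have := (follows_power hw rfl (n / 4) h0).2
    rw [length_power, zero_add] at this
    obtain ⟨-, e1, -, e2, -, e3, -⟩ := hw _ this
    have hl : wordD.length = 4 := rfl
    rw [hl] at e1 e2 e3
    have hr : n % 4 < 4 := Nat.mod_lt _ (by norm_num)
    have hd := Nat.div_add_mod n 4
    rw [h0, ← hd] at hc
    interval_cases n % 4
    · omega
    · rw [e1] at hc; omega
    · rw [show 4 * (n / 4) + 2 = 4 * (n / 4) + 1 + 1 from rfl, e2] at hc; omega
    · rw [show 4 * (n / 4) + 3 = 4 * (n / 4) + 1 + 1 + 1 from rfl, e3] at hc; omega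
  rcases Nat.mod_two_eq_zero_or_one (n / 4) with hp | hp
  · have h := exact_of_block block_checks.2.2.1 (by norm_num) hw rfl h0 (by simp [wordD])
      ((n / 4 - 8) / 2)
    rw [show wordD.length * (7 + (2 * ((n / 4 - 8) / 2) + 1)) = n by
      rw [show wordD.length = 4 from rfl]; omega] at h
    rw [hk.unique h]
    omega
  · have h := exact_of_block block_checks.2.2.2 (by norm_num) hw rfl h0 (by simp [wordD])
      ((n / 4 - 9) / 2)
    rw [show wordD.length * (7 + (2 * ((n / 4 - 9) / 2) + 2)) = n by
      rw [show wordD.length = 4 from rfl]; omega] at h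
    rw [hk.unique h]
    omega

/-- The forcing number of a cyclic sequence of cut states lies in one of the two intervals. -/
theorem value_mem {n k : ℕ} (hn : 34 ≤ n) {σ : ZMod n → ℕ} (hσ : ∀ i, Tr (σ i) (σ (i + 1)))
    (hk : ∀ p : ZMod n, Exact n (fun i => σ (p + i)) k) :
    ((n + 11) / 12 + 1 ≤ k ∧ k ≤ (n + 9) / 7 + if n % 7 = 3 then 1 else 0) ∨
      ((n + 7) / 6 ≤ k ∧ k ≤ (n + 3) / 4) := by
  have : NeZero n := ⟨by omega⟩
  have htr : ∀ (p : ZMod n) (i : ℕ), Tr (σ (p + i)) (σ (p + (i + 1 : ℕ))) := by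
    intro p i
    have := hσ (p + i)
    rwa [add_assoc, ← Nat.cast_succ] at this
  have hcl : ∀ p : ZMod n, σ (p + (n : ℕ)) = σ (p + (0 : ℕ)) := by
    intro p
    rw [ZMod.natCast_self, Nat.cast_zero]
  have hz : ∀ p : ZMod n, σ (p + (0 : ℕ)) = σ p := fun p => by rw [Nat.cast_zero, add_zero]
  have ho : ∀ p : ZMod n, σ (p + (1 : ℕ)) = σ (p + 1) := fun p => by rw [Nat.cast_one]
  have hall : ∀ (P : ℕ → Prop), (∀ x y, Tr x y → P x → P y) → ∀ p, P (σ p) → ∀ i, P (σ i) := by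
    intro P hP p hp i
    have key : ∀ m : ℕ, P (σ (p + m)) := by
      intro m
      induction m with
      | zero => rwa [hz]
      | succ m ih => exact hP _ _ (htr p m) ih
    have := key (i - p).val
    rwa [ZMod.natCast_zmod_val, add_sub_cancel] at this
  have hlow : ∀ p, ∃ T, Forces n (fun i => σ (p + i)) T ∧ cost T n = k := fun p => (hk p).1
  by_cases htype : ∃ p, σ p = 0 ∨ σ p = 3 ∨ σ p = 5 ∨ σ p = 6
  · right
    obtain ⟨p, hp⟩ := htype
    have h4 : ∀ i, σ i = 0 ∨ σ i = 3 ∨ σ i = 5 ∨ σ i = 6 :=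
      hall (fun x => x = 0 ∨ x = 3 ∨ x = 5 ∨ x = 6) (fun x y h hx => by
        have := transitions_cases h
        omega) p hp
    by_cases hB : ∀ i, σ i = 0
    · have := exact_all_B (fun i => hB _) hn (hk 0)
      omega
    · push Not at hB
      obtain ⟨i, hi⟩ := hB
      have hpred : ∀ i, Tr (σ (i - 1)) (σ i) := fun i => by
        have := hσ (i - 1)
        rwa [sub_add_cancel] at this
      obtain ⟨a, ha⟩ : ∃ a, σ a = 3 := by
        have c1 := transitions_cases (hpred i)
        have c2 := transitions_cases (hpred (i - 1))
        rcases h4 i with h | h | h | h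
        · exact absurd h hi
        · exact ⟨i, h⟩
        · exact ⟨i - 1 - 1, by omega⟩
        · exact ⟨i - 1, by omega⟩
      constructor
      · obtain ⟨T, hT, rfl⟩ := hlow a
        have := lower_bound_AB hT (hcl a) ((hz a).trans ha) (by omega)
        omega
      · by_cases hBB : ∃ b, σ b = 0 ∧ σ (b + 1) = 0
        · obtain ⟨b, hb0, hb1⟩ := hBB
          obtain ⟨T, hT, hc⟩ := upper_bound_AB (σ := fun i => σ (b + i)) (fun i _ => htr b i)
            (hcl b) ((hz b).trans hb0) ((ho b).trans hb1) (by omega)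
          exact ((hk b).2 T hT).trans hc
        · push Not at hBB
          have h0 : σ (a - 1) = 0 := by
            have := transitions_cases (hpred a)
            omega
          exact exact_all_A (s := fun i => σ (a - 1 + i)) (htr _) ((hz _).trans h0) (fun i hi => by
            have := hBB (a - 1 + i) hi.1
            rw [add_assoc, ← Nat.cast_succ] at this
            exact this hi.2) hn (hcl _) (hk _)
  · left
    push Not at htype
    have h4 : ∀ i, σ i = 1 ∨ σ i = 2 ∨ σ i = 4 ∨ σ i = 7 := fun i => by
      have := transitions_cases (hσ i)
      have := htype i
      omega
    obtain ⟨a, ha⟩ : ∃ a, σ a = 1 := by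
      have c0 := transitions_cases (hσ 0)
      have c1 := transitions_cases (hσ (0 + 1))
      have c2 := transitions_cases (hσ (0 + 1 + 1))
      rcases h4 0 with h | h | h | h
      · exact ⟨0, h⟩
      · rcases h4 (0 + 1 + 1) with h' | h' | h' | h'
        · exact ⟨_, h'⟩
        · omega
        · exact ⟨0 + 1 + 1 + 1, by omega⟩
        · omega
      · exact ⟨0 + 1, by omega⟩
      · exact ⟨0 + 1 + 1, by omega⟩
    constructor
    · obtain ⟨T, hT, rfl⟩ := hlow a
      have := lower_bound_CD hT (hcl a) ((hz a).trans ha) (by omega)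
      omega
    · by_cases hBB : ∃ b, σ b = 2 ∧ σ (b + 1) = 4
      · obtain ⟨b, hb0, hb1⟩ := hBB
        obtain ⟨T, hT, hc⟩ := upper_bound_CD (σ := fun i => σ (b + i)) (fun i _ => htr b i)
          (hcl b) ((hz b).trans hb0) ((ho b).trans hb1) (by omega)
        exact ((hk b).2 T hT).trans hc
      · push Not at hBB
        have := exact_all_D (s := fun i => σ (a + i)) (htr _) ((hz _).trans ha) (fun i hi => by
          have := hBB (a + i) hi.1
          rw [add_assoc, ← Nat.cast_succ] at this
          exact this hi.2) hn (hcl _) (hk _)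
        omega

variable {n : ℕ}

/-- The three edges of column `i`: outer edge, spoke and inner edge. -/
def edge (i : ZMod n) : Fin 3 → Sym2 (PV n) :=
  ![s(pu i, pu (i + 2)), s(pu i, pv i), s(pv i, pv (i + 1))]

theorem natCast_ne_zero {k : ℕ} (h0 : 0 < k) (hk : k < n) : (k : ZMod n) ≠ 0 :=
  (ZMod.natCast_eq_zero_iff k n).not.2 (Nat.not_dvd_of_pos_of_lt h0 hk)

theorem zmod_one_ne_zero (hn : 34 ≤ n) : (1 : ZMod n) ≠ 0 := by
  exact_mod_cast natCast_ne_zero (n := n) (k := 1) (by omega) (by omega)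

theorem zmod_two_ne_zero (hn : 34 ≤ n) : (2 : ZMod n) ≠ 0 := by
  exact_mod_cast natCast_ne_zero (n := n) (k := 2) (by omega) (by omega)

theorem zmod_four_ne_zero (hn : 34 ≤ n) : (4 : ZMod n) ≠ 0 := by
  exact_mod_cast natCast_ne_zero (n := n) (k := 4) (by omega) (by omega)

theorem petersen_edgeSet (hn : 34 ≤ n) {e : Sym2 (PV n)} :
    e ∈ (petersen n).edgeSet ↔ ∃ i j, e = edge i j := by
  have h1 := zmod_one_ne_zero hn
  have h2 := zmod_two_ne_zero hn
  induction e with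
  | _ x y =>
    simp only [SimpleGraph.mem_edgeSet, petersen, SimpleGraph.fromRel_adj,
      Fin.exists_fin_succ, edge]
    constructor
    · rintro ⟨-, (⟨i, rfl, rfl⟩ | ⟨i, rfl, rfl⟩ | ⟨i, rfl, rfl⟩) |
        (⟨i, rfl, rfl⟩ | ⟨i, rfl, rfl⟩ | ⟨i, rfl, rfl⟩)⟩ <;> refine ⟨i, ?_⟩ <;>
        simp [pu, pv]
    · rintro ⟨i, h⟩
      simp [pu, pv] at h
      rcases h with (⟨rfl, rfl⟩ | ⟨rfl, rfl⟩) | (⟨rfl, rfl⟩ | ⟨rfl, rfl⟩) |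
        (⟨rfl, rfl⟩ | ⟨rfl, rfl⟩) <;> simp [pu, pv, h1, h2]

theorem edge_injective (hn : 34 ≤ n) {i i' : ZMod n} {j j' : Fin 3} :
    edge i j = edge i' j' ↔ i = i' ∧ j = j' := by
  have h2 := zmod_two_ne_zero hn
  have h4 := zmod_four_ne_zero hn
  refine ⟨fun h => ?_, by rintro ⟨rfl, rfl⟩; rfl⟩
  fin_cases j <;> fin_cases j' <;> simp [edge, pu, pv] at h ⊢ <;> try exact h
  · rcases h with h | ⟨h, h'⟩
    · exact h
    · exact absurd (by linear_combination h' - h) h4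
  · rcases h with h | ⟨h, h'⟩
    · exact h
    · exact absurd (by linear_combination h' - h) h2

theorem adj_pu (hn : 34 ≤ n) (M : (petersen n).Subgraph) (i : ZMod n) (w : PV n) :
    M.Adj (pu i) w ↔ (w = pu (i - 2) ∧ edge (i - 2) 0 ∈ M.edgeSet) ∨
      (w = pu (i + 2) ∧ edge i 0 ∈ M.edgeSet) ∨ (w = pv i ∧ edge i 1 ∈ M.edgeSet) := by
  constructor
  · intro h
    obtain ⟨k, j, hj⟩ := (petersen_edgeSet hn).1 ((petersen n).mem_edgeSet.2 h.adj_sub)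
    have hM : edge k j ∈ M.edgeSet := hj ▸ h
    fin_cases j <;> simp [edge, pu, pv] at hj
    · rcases hj with ⟨rfl, rfl⟩ | ⟨rfl, rfl⟩
      · exact Or.inr (Or.inl ⟨rfl, hM⟩)
      · exact Or.inl ⟨by simp [pu], by simpa using hM⟩
    · obtain ⟨rfl, rfl⟩ := hj
      exact Or.inr (Or.inr ⟨rfl, hM⟩)
  · rintro (⟨rfl, h⟩ | ⟨rfl, h⟩ | ⟨rfl, h⟩)
    · simpa [edge] using Subgraph.Adj.symm h
    · exact h
    · exact h

theorem adj_pv (hn : 34 ≤ n) (M : (petersen n).Subgraph) (i : ZMod n) (w : PV n) :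
    M.Adj (pv i) w ↔ (w = pv (i - 1) ∧ edge (i - 1) 2 ∈ M.edgeSet) ∨
      (w = pv (i + 1) ∧ edge i 2 ∈ M.edgeSet) ∨ (w = pu i ∧ edge i 1 ∈ M.edgeSet) := by
  constructor
  · intro h
    obtain ⟨k, j, hj⟩ := (petersen_edgeSet hn).1 ((petersen n).mem_edgeSet.2 h.adj_sub)
    have hM : edge k j ∈ M.edgeSet := hj ▸ h
    fin_cases j <;> simp [edge, pu, pv] at hj
    · obtain ⟨rfl, rfl⟩ := hj
      exact Or.inr (Or.inr ⟨rfl, hM⟩)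
    · rcases hj with ⟨rfl, rfl⟩ | ⟨rfl, rfl⟩
      · exact Or.inr (Or.inl ⟨rfl, hM⟩)
      · exact Or.inl ⟨by simp [pv], by simpa using hM⟩
  · rintro (⟨rfl, h⟩ | ⟨rfl, h⟩ | ⟨rfl, h⟩)
    · simpa [edge] using Subgraph.Adj.symm h
    · exact h
    · exact Subgraph.Adj.symm h

open Classical in
/-- Indicator of the edges of a set. -/
noncomputable def ind (F : Set (Sym2 (PV n))) (i : ZMod n) (j : Fin 3) : ℕ :=
  if edge i j ∈ F then 1 else 0

theorem ind_le_one (F : Set (Sym2 (PV n))) (i : ZMod n) (j : Fin 3) : ind F i j ≤ 1 := by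
  unfold ind
  split <;> simp

theorem ind_eq_one {F : Set (Sym2 (PV n))} {i : ZMod n} {j : Fin 3} :
    ind F i j = 1 ↔ edge i j ∈ F := by
  simp [ind]

theorem existsUnique_or_iff {α : Type*} {x y z : α} (hxy : x ≠ y) (hxz : x ≠ z) (hyz : y ≠ z)
    {p q r : Prop} [Decidable p] [Decidable q] [Decidable r] :
    (∃! w, (w = x ∧ p) ∨ (w = y ∧ q) ∨ (w = z ∧ r)) ↔
      (if p then 1 else 0) + (if q then 1 else 0) + (if r then 1 else 0) = 1 := by
  by_cases hp : p <;> by_cases hq : q <;> by_cases hr : r <;>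
    simp [hp, hq, hr, ExistsUnique, hxy, hxz, hyz, hxy.symm, hxz.symm, hyz.symm]

open Classical in
theorem isPerfectMatching_iff_ind (hn : 34 ≤ n) (M : (petersen n).Subgraph) :
    M.IsPerfectMatching ↔ ∀ i : ZMod n,
      ind M.edgeSet (i - 2) 0 + ind M.edgeSet i 0 + ind M.edgeSet i 1 = 1 ∧
      ind M.edgeSet (i - 1) 2 + ind M.edgeSet i 2 + ind M.edgeSet i 1 = 1 := by
  have h2 := zmod_two_ne_zero hn
  have h4 := zmod_four_ne_zero hn
  rw [Subgraph.isPerfectMatching_iff, Sum.forall, ← forall_and]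
  refine forall_congr' fun i => and_congr ?_ ?_
  · have := existsUnique_or_iff (x := (pu (i - 2) : PV n)) (y := pu (i + 2)) (z := pv i)
      (p := edge (i - 2) 0 ∈ M.edgeSet) (q := edge i 0 ∈ M.edgeSet) (r := edge i 1 ∈ M.edgeSet)
      (fun h => h4 (by linear_combination - (Sum.inl_injective h))) (by simp [pu, pv])
      (by simp [pu, pv])
    simp only [← adj_pu hn] at this
    exact this
  · have := existsUnique_or_iff (x := (pv (i - 1) : PV n)) (y := pv (i + 1)) (z := pu i)
      (p := edge (i - 1) 2 ∈ M.edgeSet) (q := edge i 2 ∈ M.edgeSet) (r := edge i 1 ∈ M.edgeSet)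
      (fun h => h2 (by linear_combination - (Sum.inr_injective h))) (by simp [pu, pv])
      (by simp [pu, pv])
    simp only [← adj_pv hn] at this
    exact this

/-- The edges of a set in column `i`, as a bit mask. -/
noncomputable def mask (F : Set (Sym2 (PV n))) (i : ZMod n) : ℕ :=
  ind F i 0 + 2 * ind F i 1 + 4 * ind F i 2

/-- The cut state of an edge set before column `i`. -/
noncomputable def state (F : Set (Sym2 (PV n))) (i : ZMod n) : ℕ :=
  4 * ind F (i - 2) 0 + 2 * ind F (i - 1) 0 + ind F (i - 1) 2

theorem isSub_iff {S m : ℕ} (hm : m < 8) :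
    isSub S m = true ↔ S < 8 ∧ S % 2 ≤ m % 2 ∧ S / 2 % 2 ≤ m / 2 % 2 ∧ S / 4 ≤ m / 4 := by
  have h8 : isSub S m = true → S < 8 := by
    intro h
    rw [isSub, Nat.beq_eq] at h
    have : S &&& m ≤ m := Nat.and_le_right
    have : Nat.land S m ≤ m := this
    omega
  have key : ∀ S < 8, ∀ m < 8, isSub S m = true ↔
      S < 8 ∧ S % 2 ≤ m % 2 ∧ S / 2 % 2 ≤ m / 2 % 2 ∧ S / 4 ≤ m / 4 := by decide +kernel
  exact ⟨fun h => (key S (h8 h) m hm).1 h, fun h => (key S h.1 m hm).2 h⟩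

theorem mask_lt (F : Set (Sym2 (PV n))) (i : ZMod n) : mask F i < 8 := by
  have := ind_le_one F i 0
  have := ind_le_one F i 1
  have := ind_le_one F i 2
  unfold mask
  omega

theorem isSub_mask {S F : Set (Sym2 (PV n))} {i : ZMod n} :
    isSub (mask S i) (mask F i) = true ↔ ∀ j, edge i j ∈ S → edge i j ∈ F := by
  have a0 := ind_le_one S i 0
  have a1 := ind_le_one S i 1
  have a2 := ind_le_one S i 2
  have b0 := ind_le_one F i 0
  have b1 := ind_le_one F i 1
  have b2 := ind_le_one F i 2
  rw [isSub_iff (mask_lt F i), and_iff_right (mask_lt S i)]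
  simp only [Fin.forall_fin_succ, ← ind_eq_one, mask]
  simp
  omega

theorem popc_mask (S : Set (Sym2 (PV n))) (i : ZMod n) : popc (mask S i) = ∑ j, ind S i j := by
  have a0 := ind_le_one S i 0
  have a1 := ind_le_one S i 1
  have a2 := ind_le_one S i 2
  rw [Fin.sum_univ_three, popc, mask]
  omega

theorem IsPerfectMatching.tr (hn : 34 ≤ n) {M : (petersen n).Subgraph}
    (hM : M.IsPerfectMatching) (i : ZMod n) :
    Tr (state M.edgeSet i) (state M.edgeSet (i + 1)) ∧
      mask M.edgeSet i = colMask (state M.edgeSet i) (state M.edgeSet (i + 1)) := by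
  obtain ⟨h1, h2⟩ := (isPerfectMatching_iff_ind hn M).1 hM i
  have e0 := ind_le_one M.edgeSet (i - 1) 0
  unfold state mask Tr
  rw [show i + 1 - 2 = i - 1 by ring, add_sub_cancel_right]
  generalize ind M.edgeSet (i - 2) 0 = a at *
  generalize ind M.edgeSet (i - 1) 0 = b at *
  generalize ind M.edgeSet (i - 1) 2 = c at *
  generalize ind M.edgeSet i 0 = d at *
  generalize ind M.edgeSet i 1 = e at *
  generalize ind M.edgeSet i 2 = f at *
  have key : ∀ a b c d e f : Fin 2, (a + d + e : ℕ) = 1 →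
      (c + f + e : ℕ) = 1 → ((4 * a + 2 * b + c : ℕ), (4 * b + 2 * d + f : ℕ),
        colMask (4 * a + 2 * b + c) (4 * b + 2 * d + f)) ∈ transitions ∧
      (d + 2 * e + 4 * f : ℕ) = colMask (4 * a + 2 * b + c) (4 * b + 2 * d + f) := by
    decide +kernel
  exact key ⟨a, by omega⟩ ⟨b, by omega⟩ ⟨c, by omega⟩ ⟨d, by omega⟩ ⟨e, by omega⟩ ⟨f, by omega⟩
    h1 h2

/-- The edges recorded by a family of column masks. -/
def edgesOf (m : ZMod n → ℕ) : Set (Sym2 (PV n)) :=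
  {e | ∃ i, ∃ j : Fin 3, e = edge i j ∧ m i / 2 ^ (j : ℕ) % 2 = 1}

theorem edge_mem_edgesOf (hn : 34 ≤ n) {m : ZMod n → ℕ} {i : ZMod n} {j : Fin 3} :
    edge i j ∈ edgesOf m ↔ m i / 2 ^ (j : ℕ) % 2 = 1 := by
  constructor
  · rintro ⟨i', j', h, hm⟩
    obtain ⟨rfl, rfl⟩ := (edge_injective hn).1 h
    exact hm
  · exact fun h => ⟨i, j, rfl, h⟩

theorem ind_edgesOf (hn : 34 ≤ n) (m : ZMod n → ℕ) (i : ZMod n) (j : Fin 3) :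
    ind (edgesOf m) i j = m i / 2 ^ (j : ℕ) % 2 := by
  have h1 := ind_le_one (edgesOf m) i j
  have h2 := (ind_eq_one (F := edgesOf m) (i := i) (j := j)).trans (edge_mem_edgesOf hn)
  have := Nat.mod_lt (m i / 2 ^ (j : ℕ)) (by norm_num : 2 > 0)
  omega

theorem mask_edgesOf (hn : 34 ≤ n) {m : ZMod n → ℕ} {i : ZMod n} (h : m i < 8) :
    mask (edgesOf m) i = m i := by
  simp only [mask, ind_edgesOf hn]
  simp
  omega

theorem edgesOf_subset (hn : 34 ≤ n) (m : ZMod n → ℕ) : edgesOf m ⊆ (petersen n).edgeSet := by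
  rintro e ⟨i, j, rfl, -⟩
  exact (petersen_edgeSet hn).2 ⟨i, j, rfl⟩

theorem subset_of_mask (hn : 34 ≤ n) {S F : Set (Sym2 (PV n))} (hS : S ⊆ (petersen n).edgeSet)
    (h : ∀ i, isSub (mask S i) (mask F i) = true) : S ⊆ F := by
  intro e he
  obtain ⟨i, j, rfl⟩ := (petersen_edgeSet hn).1 (hS he)
  exact isSub_mask.1 (h i) j he

theorem eq_of_mask (hn : 34 ≤ n) {S F : Set (Sym2 (PV n))} (hS : S ⊆ (petersen n).edgeSet)
    (hF : F ⊆ (petersen n).edgeSet) (h : ∀ i, mask S i = mask F i) : S = F :=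
  (subset_of_mask hn hS fun i => h i ▸ isSub_mask.2 fun _ => id).antisymm
    (subset_of_mask hn hF fun i => h i ▸ isSub_mask.2 fun _ => id)

/-- The spanning subgraph with a given set of edges. -/
def spanning {V : Type*} {G : SimpleGraph V} {F : Set (Sym2 V)} (hF : F ⊆ G.edgeSet) :
    G.Subgraph where
  verts := Set.univ
  Adj x y := s(x, y) ∈ F
  adj_sub h := hF h
  edge_vert _ := Set.mem_univ _
  symm := ⟨fun x y h => by rwa [Sym2.eq_swap]⟩

theorem spanning_edgeSet {V : Type*} {G : SimpleGraph V} {F : Set (Sym2 V)}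
    (hF : F ⊆ G.edgeSet) : (spanning hF).edgeSet = F := by
  ext e
  induction e with
  | _ x y => exact Iff.rfl

theorem Tr.bits {x y : ℕ} (h : Tr x y) : y / 4 = x / 2 % 2 ∧
    x / 4 + y / 2 % 2 + (1 - x / 4 - y / 2 % 2) = 1 ∧
    x % 2 + y % 2 + (1 - x / 4 - y / 2 % 2) = 1 := by
  have key : ∀ e ∈ transitions, e.2.1 / 4 = e.1 / 2 % 2 ∧
      e.1 / 4 + e.2.1 / 2 % 2 + (1 - e.1 / 4 - e.2.1 / 2 % 2) = 1 ∧
      e.1 % 2 + e.2.1 % 2 + (1 - e.1 / 4 - e.2.1 / 2 % 2) = 1 := by decide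
  exact key _ h

theorem colMask_bits (x y : ℕ) : colMask x y % 2 = y / 2 % 2 ∧
    colMask x y / 2 % 2 = 1 - x / 4 - y / 2 % 2 ∧ colMask x y / 4 % 2 = y % 2 := by
  have h1 : y / 2 % 2 < 2 := Nat.mod_lt _ (by norm_num)
  have h2 : y % 2 < 2 := Nat.mod_lt _ (by norm_num)
  have h3 : 1 - x / 4 - y / 2 % 2 < 2 := by omega
  unfold colMask
  generalize 1 - x / 4 - y / 2 % 2 = c at *
  generalize y / 2 % 2 = a at *
  generalize y % 2 = b at *
  omega

theorem exists_isPerfectMatching (hn : 34 ≤ n) {τ : ZMod n → ℕ}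
    (hτ : ∀ i, Tr (τ i) (τ (i + 1))) :
    ∃ M : (petersen n).Subgraph, M.IsPerfectMatching ∧ state M.edgeSet = τ := by
  set F : Set (Sym2 (PV n)) := edgesOf fun i => colMask (τ i) (τ (i + 1)) with hFdef
  have hF : F ⊆ (petersen n).edgeSet := edgesOf_subset hn _
  have i0 : ∀ i, ind F i 0 = τ (i + 1) / 2 % 2 := fun i => by
    rw [hFdef, ind_edgesOf hn]
    simpa using (colMask_bits _ _).1
  have i1 : ∀ i, ind F i 1 = 1 - τ i / 4 - τ (i + 1) / 2 % 2 := fun i => by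
    rw [hFdef, ind_edgesOf hn]
    simpa using (colMask_bits _ _).2.1
  have i2 : ∀ i, ind F i 2 = τ (i + 1) % 2 := fun i => by
    rw [hFdef, ind_edgesOf hn]
    simpa using (colMask_bits _ _).2.2
  have hsub : ∀ i, τ i / 4 = τ (i - 1) / 2 % 2 := fun i => by
    have := (hτ (i - 1)).bits.1
    rwa [sub_add_cancel] at this
  have htwo : ∀ i : ZMod n, i - 2 + 1 = i - 1 := fun i => by ring
  refine ⟨spanning hF, (isPerfectMatching_iff_ind hn _).2 fun i => ?_, funext fun i => ?_⟩
  · obtain ⟨-, h1, h2⟩ := (hτ i).bits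
    simp only [spanning_edgeSet, i0, i1, i2, sub_add_cancel, htwo, ← hsub]
    exact ⟨h1, h2⟩
  · have := (hτ i).left_lt
    simp only [spanning_edgeSet, state, i0, i2, sub_add_cancel, htwo, ← hsub]
    omega

theorem exists_eq_add_natCast [NeZero n] (p x : ZMod n) : ∃ i < n, x = p + (i : ℕ) :=
  ⟨(x - p).val, ZMod.val_lt _, by rw [ZMod.natCast_zmod_val, add_sub_cancel]⟩

theorem sum_range_add [NeZero n] (p : ZMod n) (f : ZMod n → ℕ) :
    ∑ i ∈ Finset.range n, f (p + (i : ℕ)) = ∑ x, f x := by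
  refine Finset.sum_nbij' (fun i => p + (i : ℕ)) (fun x => (x - p).val) (fun _ _ => by simp)
    (fun x _ => Finset.mem_range.2 (ZMod.val_lt _)) (fun i hi => ?_) (fun x _ => ?_) fun _ _ => rfl
  · rw [add_sub_cancel_left, ZMod.val_cast_of_lt (Finset.mem_range.1 hi)]
  · rw [ZMod.natCast_zmod_val, add_sub_cancel]

theorem ncard_eq_sum [NeZero n] (hn : 34 ≤ n) {S : Set (Sym2 (PV n))}
    (hS : S ⊆ (petersen n).edgeSet) : S.ncard = ∑ i, popc (mask S i) := by
  classical
  have himage : S = (fun x : ZMod n × Fin 3 => edge x.1 x.2) '' {x | edge x.1 x.2 ∈ S} := by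
    ext e
    constructor
    · intro he
      obtain ⟨i, j, rfl⟩ := (petersen_edgeSet hn).1 (hS he)
      exact ⟨(i, j), he, rfl⟩
    · rintro ⟨x, hx, rfl⟩
      exact hx
  have hinj : Function.Injective fun x : ZMod n × Fin 3 => edge x.1 x.2 := fun x y h =>
    Prod.ext_iff.2 ((edge_injective hn).1 h)
  conv_lhs => rw [himage]
  rw [Set.ncard_image_of_injective _ hinj, Set.ncard_eq_toFinset_card', Set.toFinset_ofPred,
    Finset.card_filter, Fintype.sum_prod_type]
  simp only [popc_mask, ind]

theorem subset_iff_consistent [NeZero n] (hn : 34 ≤ n) {M : (petersen n).Subgraph}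
    (hM : M.IsPerfectMatching) {S : Set (Sym2 (PV n))} (hS : S ⊆ (petersen n).edgeSet)
    (p : ZMod n) : S ⊆ M.edgeSet ↔
      Consistent (fun i => mask S (p + i)) (fun i => state M.edgeSet (p + i)) n := by
  have hs : ∀ i : ℕ, p + (i + 1 : ℕ) = p + i + 1 := fun i => by push_cast; ring
  constructor
  · intro h i _
    obtain ⟨h1, h2⟩ := IsPerfectMatching.tr hn hM (p + i)
    simp only [hs, ← h2]
    exact ⟨h1, isSub_mask.2 fun j hj => h hj⟩
  · intro h
    refine subset_of_mask hn hS fun x => ?_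
    obtain ⟨i, hi, rfl⟩ := exists_eq_add_natCast p x
    have := (h i hi).2
    simp only [hs] at this
    rwa [← (IsPerfectMatching.tr hn hM (p + i)).2] at this

theorem IsPerfectMatching.ext_state (hn : 34 ≤ n) {M M' : (petersen n).Subgraph}
    (hM : M.IsPerfectMatching) (hM' : M'.IsPerfectMatching)
    (h : state M.edgeSet = state M'.edgeSet) : M = M' := by
  have he : M.edgeSet = M'.edgeSet := eq_of_mask hn M.edgeSet_subset M'.edgeSet_subset fun i => by
    rw [(IsPerfectMatching.tr hn hM i).2, (IsPerfectMatching.tr hn hM' i).2, h]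
  refine Subgraph.ext ?_ ?_
  · rw [hM.2.verts_eq_univ, hM'.2.verts_eq_univ]
  · ext x y
    exact Set.ext_iff.1 he s(x, y)

theorem isForcingSet_iff [NeZero n] (hn : 34 ≤ n) {M : (petersen n).Subgraph}
    (hM : M.IsPerfectMatching) {S : Set (Sym2 (PV n))} (hS : S ⊆ (petersen n).edgeSet)
    (p : ZMod n) : IsForcingSet (petersen n) M S ↔
      Forces n (fun i => state M.edgeSet (p + i)) (fun i => mask S (p + i)) := by
  refine and_congr (subset_iff_consistent hn hM hS p) ⟨fun h q hq hc => ?_, fun h M' hM' hS' => ?_⟩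
  · set τ : ZMod n → ℕ := fun x => q (x - p).val with hτ
    have hτq : ∀ i ≤ n, τ (p + (i : ℕ)) = q i := by
      intro i hi
      rcases hi.lt_or_eq with hi | rfl
      · simp only [hτ, add_sub_cancel_left, ZMod.val_cast_of_lt hi]
      · simp [hτ, hq]
    have htr : ∀ x, Tr (τ x) (τ (x + 1)) := by
      intro x
      obtain ⟨i, hi, rfl⟩ := exists_eq_add_natCast p x
      have := (hc i hi).1
      rwa [← hτq i hi.le, ← hτq (i + 1) hi, Nat.cast_succ, ← add_assoc] at this
    obtain ⟨M', hM', hst⟩ := exists_isPerfectMatching hn htr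
    have : M' = M := h M' hM' ((subset_iff_consistent hn hM' hS p).2 fun i hi => by
      simp only [hst, hτq i hi.le, hτq (i + 1) hi]
      exact hc i hi)
    intro i hi
    simp only [← this, hst, hτq i hi]
  · refine IsPerfectMatching.ext_state hn hM' hM (funext fun x => ?_)
    obtain ⟨i, hi, rfl⟩ := exists_eq_add_natCast p x
    exact h (fun i => state M'.edgeSet (p + i)) (by simp)
      ((subset_iff_consistent hn hM' hS p).1 hS') i hi.le

theorem Consistent.congr {T T' p p' : ℕ → ℕ} {k : ℕ} (h : Consistent T p k)
    (hT : ∀ i < k, T i = T' i) (hp : ∀ i ≤ k, p i = p' i) : Consistent T' p' k := fun i hi => by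
  rw [← hT i hi, ← hp i hi.le, ← hp (i + 1) hi]
  exact h i hi

theorem Forces.congr {σ σ' T T' : ℕ → ℕ} (h : Forces n σ T) (hσ : ∀ i ≤ n, σ i = σ' i)
    (hT : ∀ i < n, T i = T' i) : Forces n σ' T' :=
  ⟨h.1.congr hT hσ, fun p hp hc i hi =>
    (h.2 p hp (hc.congr (fun i hi => (hT i hi).symm) fun _ _ => rfl) i hi).trans (hσ i hi)⟩

theorem Exact.congr {σ σ' : ℕ → ℕ} {k : ℕ} (h : Exact n σ k) (hσ : ∀ i ≤ n, σ i = σ' i) :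
    Exact n σ' k := by
  obtain ⟨⟨T, hT, hk⟩, hmin⟩ := h
  exact ⟨⟨T, hT.congr hσ fun _ _ => rfl, hk⟩,
    fun T hT => hmin T (hT.congr (fun i hi => (hσ i hi).symm) fun _ _ => rfl)⟩

theorem colMask_lt (x y : ℕ) : colMask x y < 8 := by
  unfold colMask
  omega

theorem IsPerfectMatching.eq_of_edgeSet_subset {V : Type*} {G : SimpleGraph V} {M M' : G.Subgraph}
    (hM : M.IsPerfectMatching) (hM' : M'.IsPerfectMatching) (h : M.edgeSet ⊆ M'.edgeSet) :
    M = M' := by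
  have hadj : ∀ x y, M.Adj x y → M'.Adj x y := fun x y hxy => h (show s(x, y) ∈ M.edgeSet from hxy)
  refine Subgraph.ext ?_ ?_
  · rw [hM.2.verts_eq_univ, hM'.2.verts_eq_univ]
  · ext x y
    refine ⟨hadj x y, fun hxy => ?_⟩
    obtain ⟨z, hz, -⟩ := hM.1 (hM.2 x)
    rwa [(hM'.1 (hM'.2 x)).unique hxy (hadj x z hz)]

/-- The forcing number of a perfect matching, in terms of its cut states. -/
theorem exact_forcingNumber [NeZero n] (hn : 34 ≤ n) {M : (petersen n).Subgraph}
    (hM : M.IsPerfectMatching) (p : ZMod n) :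
    Exact n (fun i => state M.edgeSet (p + i)) (forcingNumber (petersen n) M) := by
  have hcost : ∀ S ⊆ (petersen n).edgeSet, cost (fun i => mask S (p + i)) n = S.ncard :=
    fun S hS => by rw [ncard_eq_sum hn hS, ← sum_range_add p]; rfl
  have hsub : ∀ S, IsForcingSet (petersen n) M S → S ⊆ (petersen n).edgeSet :=
    fun S hS => hS.1.trans M.edgeSet_subset
  have hne : {k | ∃ S : Set (Sym2 (PV n)), IsForcingSet (petersen n) M S ∧ S.ncard = k}.Nonempty :=
    ⟨_, M.edgeSet, ⟨subset_rfl, fun M' hM' h =>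
      (IsPerfectMatching.eq_of_edgeSet_subset hM hM' h).symm⟩, rfl⟩
  constructor
  · obtain ⟨S, hS, hk⟩ := Nat.sInf_mem hne
    exact ⟨_, (isForcingSet_iff hn hM (hsub S hS) p).1 hS, (hcost S (hsub S hS)).trans hk⟩
  · intro T hT
    have h8 : ∀ i < n, T i < 8 := fun i hi =>
      ((isSub_iff (colMask_lt _ _)).1 (hT.1 i hi).2).1
    set S : Set (Sym2 (PV n)) := edgesOf fun x => T (x - p).val with hSdef
    have hS : S ⊆ (petersen n).edgeSet := edgesOf_subset hn _
    have hTS : ∀ i < n, T i = mask S (p + i) := fun i hi => by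
      rw [mask_edgesOf hn (h8 _ (ZMod.val_lt _)), add_sub_cancel_left, ZMod.val_cast_of_lt hi]
    have hc : cost T n = S.ncard := by
      rw [← hcost S hS]
      exact Finset.sum_congr rfl fun i hi => by rw [hTS i (Finset.mem_range.1 hi)]
    rw [hc]
    exact Nat.sInf_le ⟨S, (isForcingSet_iff hn hM hS p).2 (hT.congr (fun _ _ => rfl) hTS), rfl⟩

theorem Realizable.exists_isPerfectMatching (hn : 34 ≤ n) {k : ℕ} (h : Realizable n k) :
    ∃ M : (petersen n).Subgraph, M.IsPerfectMatching ∧ forcingNumber (petersen n) M = k := by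
  have : NeZero n := ⟨by omega⟩
  obtain ⟨s, hs, hc, hk⟩ := h
  have hval : ∀ i ≤ n, s (i : ZMod n).val = s i := fun i hi => by
    rcases hi.lt_or_eq with hi | rfl
    · rw [ZMod.val_cast_of_lt hi]
    · simp [hc]
  obtain ⟨M, hM, hst⟩ := PetersenForcing.exists_isPerfectMatching (τ := fun x => s x.val) hn
    fun x => by
      obtain ⟨i, hi, rfl⟩ := exists_eq_add_natCast 0 x
      rw [zero_add, ← Nat.cast_succ, hval i hi.le, hval (i + 1) hi]
      exact hs i hi
  refine ⟨M, hM, ((exact_forcingNumber hn hM 0).congr fun i hi => ?_).unique hk⟩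
  simp only [hst, zero_add, hval i hi]

end PetersenForcing

/-- for `n ≥ 34` the forcing spectrum of `P(n,2)` is the union of the two
integer intervals `[⌈n/12⌉+1, ⌈(n+3)/7⌉+δ(n)]` and `[⌈(n+2)/6⌉, ⌈n/4⌉]`, where
`δ(n) = 1` if `n ≡ 3 (mod 7)` and `δ(n) = 0` otherwise (ceilings written via natural
division). -/
theorem forcing_spectrum_eq (n : ℕ) (hn : 34 ≤ n) :
    {k | ∃ M : (petersen n).Subgraph,
        M.IsPerfectMatching ∧ forcingNumber (petersen n) M = k} =
      Set.Icc ((n + 11) / 12 + 1) ((n + 9) / 7 + if n % 7 = 3 then 1 else 0) ∪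
      Set.Icc ((n + 7) / 6) ((n + 3) / 4) := by
  have : NeZero n := ⟨by omega⟩
  ext k
  constructor
  · rintro ⟨M, hM, rfl⟩
    exact PetersenForcing.value_mem hn (fun i => (PetersenForcing.IsPerfectMatching.tr hn hM i).1)
      (PetersenForcing.exact_forcingNumber hn hM)
  · rintro (⟨h1, h2⟩ | ⟨h1, h2⟩)
    · exact (PetersenForcing.realizable_of_mem_lower_interval hn h1 h2).exists_isPerfectMatching hn
    · exact (PetersenForcing.realizable_of_mem_upper_interval hn h1 h2).exists_isPerfectMatching hn
end

section
/- Let n ≥ 11 and let R be a subset of the vertex set of P(n,2) with u_i, v_{i+1}, v_{i+5} ∈ R and u_{i+2}, v_{i+2}, v_{i+3}, u_{i+4}, v_{i+4} ∉ R. Then the spoke u_{i+2} v_{i+2} belongs to every perfect matching of the induced subgraph P(n,2) − R, provided such a perfect matching exists. -/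
open SimpleGraph

theorem petersen_adj_pu {n : ℕ} {a : ZMod n} {y : PV n} (h : (petersen n).Adj (pu a) y) :
    y = pu (a + 2) ∨ y = pu (a - 2) ∨ y = pv a := by
  rw [petersen, SimpleGraph.fromRel_adj] at h
  rcases h.2 with (⟨j, hj, rfl⟩ | ⟨j, hj, rfl⟩ | ⟨j, hj, -⟩) |
    (⟨j, rfl, hj⟩ | ⟨j, -, hj⟩ | ⟨j, -, hj⟩) <;> simp_all [pu, pv]

theorem petersen_adj_pv {n : ℕ} {a : ZMod n} {y : PV n} (h : (petersen n).Adj (pv a) y) :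
    y = pv (a + 1) ∨ y = pv (a - 1) ∨ y = pu a := by
  rw [petersen, SimpleGraph.fromRel_adj] at h
  rcases h.2 with (⟨j, hj, -⟩ | ⟨j, hj, -⟩ | ⟨j, hj, rfl⟩) |
    (⟨j, -, hj⟩ | ⟨j, rfl, hj⟩ | ⟨j, rfl, hj⟩) <;> simp_all [pu, pv]

/-- if `u_i, v_{i+1}, v_{i+5} ∈ R` and
`u_{i+2}, v_{i+2}, v_{i+3}, u_{i+4}, v_{i+4} ∉ R`, then the spoke `u_{i+2} v_{i+2}`
belongs to every perfect matching of `P(n,2) − R` (formalized as a matching subgraph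
of `P(n,2)` whose vertex set is exactly the complement of `R`). -/
theorem forced_spoke (n : ℕ) (hn : 11 ≤ n) (i : ZMod n) (R : Set (PV n))
    (h1 : pu i ∈ R) (h2 : pv (i + 1) ∈ R) (h3 : pv (i + 5) ∈ R)
    (h4 : pu (i + 2) ∉ R) (h5 : pv (i + 2) ∉ R) (h6 : pv (i + 3) ∉ R)
    (h7 : pu (i + 4) ∉ R) (h8 : pv (i + 4) ∉ R)
    (M : (petersen n).Subgraph) (hM : M.IsMatching) (hV : M.verts = Rᶜ) :
    s(pu (i + 2), pv (i + 2)) ∈ M.edgeSet := by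
  have mate (x : PV n) (hx : x ∉ R) : ∃ y, M.Adj x y := (hM (by rwa [hV])).exists
  have unmatched (x y : PV n) (hy : y ∈ R) : ¬ M.Adj x y := fun h =>
    (hV ▸ M.edge_vert h.symm : y ∈ Rᶜ) hy
  have unique {x y z : PV n} (hy : M.Adj x y) (hz : M.Adj x z) : y = z :=
    hM.eq_of_adj_left hy hz
  rw [SimpleGraph.Subgraph.mem_edgeSet]
  obtain ⟨a, ha⟩ := mate _ h4
  rcases petersen_adj_pu ha.adj_sub with rfl | rfl | rfl
  · rw [show i + 2 + 2 = i + 4 by ring] at ha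
    obtain ⟨b, hb⟩ := mate _ h5
    obtain ⟨c, hc⟩ := mate _ h8
    rcases petersen_adj_pv hb.adj_sub with rfl | rfl | rfl
    · rcases petersen_adj_pv hc.adj_sub with rfl | rfl | rfl
      · rw [show i + 4 + 1 = i + 5 by ring] at hc
        exact (unmatched _ _ h3 hc).elim
      · rw [show i + 4 - 1 = i + 2 + 1 by ring] at hc
        have h := Sum.inr_injective (unique hb.symm hc.symm)
        have h2 : ((2 : ℕ) : ZMod n) = 0 := by push_cast; linear_combination -h
        have := Nat.le_of_dvd two_pos ((ZMod.natCast_eq_zero_iff 2 n).1 h2)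
        omega
      · exact (Sum.inl_ne_inr (unique ha.symm hc.symm)).elim
    · rw [show i + 2 - 1 = i + 1 by ring] at hb
      exact (unmatched _ _ h2 hb).elim
    · exact hb.symm
  · rw [add_sub_cancel_right] at ha
    exact (unmatched _ _ h1 ha).elim
  · exact ha
end
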